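/- arXiv:1312.3837 — 9 statements merged into one kernel-verified Lean document; each statement's English description precedes it below -/
import Mathlib

section
/- If there exists a Golomb ruler of order k and length L, then for every integer v with v ≥ 2L + 1 there exists a cyclic symmetric configuration v_k; that is, there exists a circulant v×v 0,1-matrix with exactly k ones in every row and column and with no 2×2omes all-ones submatrix. -/
/-- A 0,1-matrix (given as a `Bool`-valued function) contains no 2×2 all-ones
submatrix: there are no two distinct row indices and two distinct column
indices such that all four corresponding entries are 1. -/
def NoRect {α β : Type*} (M : α → β → Bool) : Prop :=
  ∀ i₁ i₂ j₁ j₂, i₁ ≠ i₂ → j₁ ≠ j₂ →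
    M i₁ j₁ = true → M i₁ j₂ = true → M i₂ j₁ = true → M i₂ j₂ = true → False

/-- `M` is an incidence matrix of a symmetric configuration with parameter `k`:
every row and every column contains exactly `k` ones, and there is no
2×2 all-ones submatrix. -/
def IsIncidence {α β : Type*} [Fintype α] [Fintype β]
    (k : ℕ) (M : α → β → Bool) : Prop :=
  (∀ i : α, (Finset.univ.filter (fun j => M i j = true)).card = k) ∧
  (∀ j : β, (Finset.univ.filter (fun i => M i j = true)).card = k) ∧
  NoRect M

/-- A symmetric configuration `v_k` exists: there is a `v × v` 0,1-matrix with
exactly `k` ones in every row and column and no 2×2 all-ones submatrix. -/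
def ConfigExists (v k : ℕ) : Prop :=
  ∃ M : Fin v → Fin v → Bool, IsIncidence k M

/-- `A` is a `(v,k)` modular Golomb ruler: a `k`-element subset of `ℤ/vℤ`
such that all differences `a - a'` with `a ≠ a'` in `A` are nonzero and
pairwise distinct. -/
def IsModularGolombRuler (v k : ℕ) (A : Finset (ZMod v)) : Prop :=
  A.card = k ∧
  (∀ a ∈ A, ∀ a' ∈ A, a ≠ a' → a - a' ≠ 0) ∧
  (∀ a ∈ A, ∀ a' ∈ A, ∀ b ∈ A, ∀ b' ∈ A, a ≠ a' → b ≠ b' →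
    a - a' = b - b' → a = b ∧ a' = b')

/-- `a` is a Golomb ruler of order `k`: `k` nonnegative integers in strictly
increasing order all of whose differences `a i - a j` with `i ≠ j` are
pairwise distinct. -/
def IsGolombRuler (k : ℕ) (a : Fin k → ℤ) : Prop :=
  (∀ i, 0 ≤ a i) ∧ StrictMono a ∧
  (∀ i j i' j' : Fin k, i ≠ j → i' ≠ j' → a i - a j = a i' - a j' → i = i' ∧ j = j')

/-- If a Golomb ruler of order `k` and length `L` exists, then for every
`v ≥ 2L + 1` a cyclic symmetric configuration `v_k` exists: there is a
circulant `v × v` 0,1-matrix with exactly `k` ones in every row and column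
and no 2×2 all-ones submatrix. -/
theorem cyclic_config_of_golomb_ruler (k : ℕ) (hk : 0 < k) (a : Fin k → ℤ)
    (ha : IsGolombRuler k a)
    (L : ℤ) (hL : L = a ⟨k - 1, by omega⟩ - a ⟨0, hk⟩)
    (v : ℕ) (hv : 2 * L + 1 ≤ (v : ℤ)) :
    ∃ c : Fin v → Bool, IsIncidence k (fun i j : Fin v => c (j - i)) := by
  classical
  obtain ⟨_, hm, hd⟩ := ha
  have hlo : ∀ i, a ⟨0, hk⟩ ≤ a i := fun i => hm.monotone (by
    rw [Fin.le_def]; exact Nat.zero_le _)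
  have hhi : ∀ i, a i ≤ a ⟨k - 1, by omega⟩ := fun i => hm.monotone (by
    rw [Fin.le_def]; have := i.isLt; simp only; omega)
  have hv0 : 0 < v := by
    have := hlo ⟨k - 1, by omega⟩
    omega
  haveI : NeZero v := ⟨hv0.ne'⟩
  have hlt : ∀ i, (a i - a ⟨0, hk⟩).toNat < v := fun i => by
    have h1 := hlo i
    have h2 := hhi i
    omega
  obtain ⟨f, hf⟩ : ∃ f : Fin k → Fin v, ∀ i, ((f i : ℕ) : ℤ) = a i - a ⟨0, hk⟩ :=
    ⟨fun i => ⟨(a i - a ⟨0, hk⟩).toNat, hlt i⟩, fun i => by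
      have h1 := hlo i
      simp only
      omega⟩
  have key : ∀ p q r s : Fin k, f p + f s = f r + f q → a p - a q = a r - a s := by
    intro p q r s h
    have h' := congrArg Fin.val h
    rw [Fin.val_add, Fin.val_add] at h'
    have hp := hf p
    have hq := hf q
    have hr := hf r
    have hs := hf s
    have h1 := hhi p
    have h2 := hhi q
    have h3 := hhi r
    have h4 := hhi s
    rw [Nat.mod_eq_of_lt (by omega), Nat.mod_eq_of_lt (by omega)] at h'
    omega
  have finj : Function.Injective f := by
    intro p q h
    apply hm.injective
    have h1 := hf p
    have h2 := hf q
    rw [h] at h1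
    omega
  refine ⟨fun x => decide (∃ i, f i = x), ?_, ?_, ?_⟩
  · intro i
    have : (Finset.univ.filter (fun j : Fin v => decide (∃ s, f s = j - i) = true))
        = Finset.univ.image (fun s => f s + i) := by
      ext j
      simp [eq_sub_iff_add_eq]
    rw [this, Finset.card_image_of_injective _ (fun p q h => finj (add_right_cancel h))]
    simp
  · intro j
    have : (Finset.univ.filter (fun i : Fin v => decide (∃ s, f s = j - i) = true))
        = Finset.univ.image (fun s => j - f s) := by
      ext i
      simp only [Finset.mem_filter, Finset.mem_univ, true_and, decide_eq_true_eq,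
        Finset.mem_image]
      refine exists_congr fun s => ⟨fun h => ?_, fun h => ?_⟩
      · rw [h]; abel
      · rw [← h]; abel
    rw [this, Finset.card_image_of_injective _ (fun p q h => finj (sub_right_injective h))]
    simp
  · intro i₁ i₂ j₁ j₂ hi hj h11 h12 h21 h22
    simp only [decide_eq_true_eq] at h11 h12 h21 h22
    obtain ⟨p, hp⟩ := h11
    obtain ⟨q, hq⟩ := h12
    obtain ⟨r, hr⟩ := h21
    obtain ⟨s, hs⟩ := h22
    have hpq : p ≠ q := by
      rintro rfl
      exact hj (sub_left_injective (hp.symm.trans hq))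
    have hrs : r ≠ s := by
      rintro rfl
      exact hj (sub_left_injective (hr.symm.trans hs))
    have h := hd p q r s hpq hrs (key p q r s (by rw [hp, hq, hr, hs]; abel))
    obtain ⟨rfl, -⟩ := h
    exact hi (sub_right_injective (hp.symm.trans hr))
end

section
/- If a symmetric configuration v_k exists, then for each δ with 0 ≤ δ < k a symmetric configuration v_{k−δ} exists; that is, if there is a v×v 0,1-matrix with exactly k ones in every row and column and no 2×2 all-ones submatrix, then for each δ with 0 ≤ δ < k there is a v×v 0,1-matrix with exactly k−δ ones in every row and column and no 2×2 all-ones submatrix. -/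
/-- Removing a perfect matching (Hall) lowers the row and column sums by one. -/
theorem config_step (v k : ℕ) (h : ConfigExists v (k + 1)) : ConfigExists v k := by
  obtain ⟨M, hr, hc, hn⟩ := h
  have hall : ∀ s : Finset (Fin v),
      s.card ≤ (s.biUnion (fun i => Finset.univ.filter (fun j => M i j = true))).card := by
    intro s
    have := Finset.card_mul_le_card_mul (fun i j => M i j = true) (s := s)
      (t := s.biUnion (fun i => Finset.univ.filter (fun j => M i j = true)))
      (m := k + 1) (n := k + 1) ?_ ?_
    · exact Nat.le_of_mul_le_mul_right this (Nat.succ_pos k)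
    · intro a ha
      rw [← hr a]
      apply Finset.card_le_card
      intro j hj
      rw [Finset.mem_bipartiteAbove]
      exact ⟨Finset.mem_biUnion.2 ⟨a, ha, hj⟩, (Finset.mem_filter.1 hj).2⟩
    · intro b _
      rw [← hc b]
      apply Finset.card_le_card
      intro i hi
      rw [Finset.mem_bipartiteBelow] at hi
      exact Finset.mem_filter.2 ⟨Finset.mem_univ _, hi.2⟩
  obtain ⟨f, hf, hfm⟩ := (Finset.all_card_le_biUnion_card_iff_exists_injective _).1 hall
  have hM : ∀ i, M i (f i) = true := fun i => (Finset.mem_filter.1 (hfm i)).2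
  have hs : Function.Surjective f := Finite.surjective_of_injective hf
  refine ⟨fun i j => M i j && !decide (f i = j), ?_, ?_, ?_⟩
  · intro i
    have : (Finset.univ.filter (fun j => (M i j && !decide (f i = j)) = true))
        = (Finset.univ.filter (fun j => M i j = true)).erase (f i) := by
      ext j
      simp [and_comm, eq_comm (a := j)]
    rw [this, Finset.card_erase_of_mem (hfm i), hr i]
    rfl
  · intro j
    obtain ⟨i, rfl⟩ := hs j
    have : (Finset.univ.filter (fun i' => (M i' (f i) && !decide (f i' = f i)) = true))
        = (Finset.univ.filter (fun i' => M i' (f i) = true)).erase i := by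
      ext i'
      simp [and_comm, hf.eq_iff]
    rw [this, Finset.card_erase_of_mem (by simp [hM i]), hc (f i)]
    rfl
  · intro i₁ i₂ j₁ j₂ hi hj h1 h2 h3 h4
    simp only [Bool.and_eq_true] at h1 h2 h3 h4
    exact hn i₁ i₂ j₁ j₂ hi hj h1.1 h2.1 h3.1 h4.1

/-- If a symmetric configuration `v_k` exists, then for each `δ < k` a
symmetric configuration `v_{k-δ}` exists. -/
theorem config_exists_of_sub (v k : ℕ) (h : ConfigExists v k)
    (δ : ℕ) (hδ : δ < k) :
    ConfigExists v (k - δ) := by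
  induction δ with
  | zero => exact h
  | succ d ih =>
    apply config_step
    have e : k - (d + 1) + 1 = k - d := by omega
    rw [e]
    exact ih (by omega)
end

section
/- Let p be an odd prime and let g be a primitive root modulo p. Then the p − 1 residues e_u = p·u + (p−1)·g^u modulo p² − p, for u = 1, 2, …, p − 1, are pairwise distinct and form a (p² − p, p − 1) modular Golomb ruler (Ruzsa's construction). -/
lemma ruzsa_key (p : ℕ) (hp : p.Prime) (g : ℕ) (hg : IsPrimitiveRoot (g : ZMod p) (p - 1))
    (a b c d : ℕ)
    (h : (((p * a + (p - 1) * g ^ a) + (p * b + (p - 1) * g ^ b) : ℕ) : ZMod (p ^ 2 - p)) =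
      (((p * c + (p - 1) * g ^ c) + (p * d + (p - 1) * g ^ d) : ℕ) : ZMod (p ^ 2 - p))) :
    (g : ZMod p) ^ a = (g : ZMod p) ^ c ∨ (g : ZMod p) ^ a = (g : ZMod p) ^ d := by
  have : Fact p.Prime := ⟨hp⟩
  obtain ⟨q, rfl⟩ : ∃ q, p = q + 1 := ⟨p - 1, by have := hp.pos; omega⟩
  have hv : (q + 1) ^ 2 - (q + 1) = (q + 1) * q := by
    have : (q + 1) ^ 2 = (q + 1) * q + (q + 1) := by ring
    omega
  rw [hv, ZMod.natCast_eq_natCast_iff] at h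
  simp only [Nat.add_sub_cancel] at h hg
  have h1 := h.of_mul_right q
  have h2 := h.of_mul_left (q + 1)
  rw [← ZMod.natCast_eq_natCast_iff] at h1 h2
  have hq0 : ((q : ℕ) : ZMod (q + 1)) = -1 := by
    have : ((q + 1 : ℕ) : ZMod (q + 1)) = 0 := ZMod.natCast_self _
    push_cast at this
    linear_combination this
  have hp0 : ((q : ℕ) : ZMod (q + 1)) + 1 = 0 := by rw [hq0]; ring
  push_cast at h1 h2
  rw [hp0, hq0] at h1
  have hs : (g : ZMod (q + 1)) ^ a + (g : ZMod (q + 1)) ^ b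
      = (g : ZMod (q + 1)) ^ c + (g : ZMod (q + 1)) ^ d := by
    linear_combination -h1
  have h3 : ((a + b : ℕ) : ZMod q) = ((c + d : ℕ) : ZMod q) := by
    have : ((q : ℕ) : ZMod q) = 0 := ZMod.natCast_self _
    rw [this] at h2
    push_cast
    linear_combination h2
  rw [ZMod.natCast_eq_natCast_iff] at h3
  have hm : (g : ZMod (q + 1)) ^ (a + b) = (g : ZMod (q + 1)) ^ (c + d) := by
    rw [← pow_mod_orderOf, ← hg.eq_orderOf, h3, ← pow_mod_orderOf _ (c + d), ← hg.eq_orderOf]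
  rw [pow_add, pow_add] at hm
  have : ((g : ZMod (q + 1)) ^ a - (g : ZMod (q + 1)) ^ c) *
      ((g : ZMod (q + 1)) ^ a - (g : ZMod (q + 1)) ^ d) = 0 := by
    linear_combination (g : ZMod (q + 1)) ^ a * hs - hm
  rcases mul_eq_zero.mp this with h | h
  · left; exact sub_eq_zero.mp h
  · right; exact sub_eq_zero.mp h

lemma ruzsa_pow_inj (p : ℕ) (hp : p.Prime) (g : ℕ)
    (hg : IsPrimitiveRoot (g : ZMod p) (p - 1)) (a b : ℕ)
    (ha : a ∈ Finset.Icc 1 (p - 1)) (hb : b ∈ Finset.Icc 1 (p - 1))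
    (h : (g : ZMod p) ^ a = (g : ZMod p) ^ b) : a = b := by
  have : Fact p.Prime := ⟨hp⟩
  rw [Finset.mem_Icc] at ha hb
  have hg0 : (g : ZMod p) ≠ 0 := hg.ne_zero (by omega)
  obtain ⟨a, rfl⟩ : ∃ k, a = k + 1 := ⟨a - 1, by omega⟩
  obtain ⟨b, rfl⟩ : ∃ k, b = k + 1 := ⟨b - 1, by omega⟩
  rw [pow_succ, pow_succ] at h
  rw [hg.pow_inj (by omega) (by omega) (mul_right_cancel₀ hg0 h)]

theorem ruzsa_modular_golomb_ruler (p : ℕ) (hp : p.Prime) (hodd : Odd p)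
    (g : ℕ) (hg : IsPrimitiveRoot (g : ZMod p) (p - 1)) :
    Set.InjOn (fun u : ℕ => ((p * u + (p - 1) * g ^ u : ℕ) : ZMod (p ^ 2 - p)))
      ↑(Finset.Icc 1 (p - 1)) ∧
    IsModularGolombRuler (p ^ 2 - p) (p - 1)
      ((Finset.Icc 1 (p - 1)).image
        (fun u : ℕ => ((p * u + (p - 1) * g ^ u : ℕ) : ZMod (p ^ 2 - p)))) := by
  have hinj : Set.InjOn (fun u : ℕ => ((p * u + (p - 1) * g ^ u : ℕ) : ZMod (p ^ 2 - p)))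
      ↑(Finset.Icc 1 (p - 1)) := by
    intro a ha b hb hab
    rw [Finset.mem_coe] at ha hb
    have hab' : ((p * a + (p - 1) * g ^ a : ℕ) : ZMod (p ^ 2 - p))
      = ((p * b + (p - 1) * g ^ b : ℕ) : ZMod (p ^ 2 - p)) := hab
    refine ruzsa_pow_inj p hp g hg a b ha hb ?_
    refine (or_self_iff).mp (ruzsa_key p hp g hg a a b b ?_)
    rw [Nat.cast_add, hab', ← Nat.cast_add]
  refine ⟨hinj, ?_, ?_, ?_⟩
  · rw [Finset.card_image_of_injOn hinj, Nat.card_Icc]; omega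
  · intro a _ b _ hab
    exact sub_ne_zero.mpr hab
  · intro a ha a' ha' b hb b' hb' hne _ h
    rw [Finset.mem_image] at ha ha' hb hb'
    obtain ⟨u, hu, rfl⟩ := ha
    obtain ⟨u', hu', rfl⟩ := ha'
    obtain ⟨w, hw, rfl⟩ := hb
    obtain ⟨w', hw', rfl⟩ := hb'
    rcases ruzsa_key p hp g hg u w' w u' (by
      have h' := sub_eq_sub_iff_add_eq_add.mp h
      rw [← Nat.cast_add, ← Nat.cast_add] at h'
      exact h') with h1 | h1
    · have := ruzsa_pow_inj p hp g hg u w hu hw h1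
      subst this
      exact ⟨rfl, sub_right_inj.mp h⟩
    · have := ruzsa_pow_inj p hp g hg u u' hu hu' h1
      subst this
      exact absurd rfl hne
end

section
/- For every prime power q there exists a (q² + q + 1, q + 1) modular Golomb ruler; equivalently, a cyclic symmetric configuration v_{q+1} with v = q² + q + 1 exists (coming from the cyclic projective plane PG(2,q) with a Singer cycle). -/
/-- The affine points `θ + a` together with `1`, parametrising a projective line. -/
def singerPt {F K : Type*} [Field F] [Field K] [Algebra F K] (θ : K) : Option F → K
  | none => 1
  | some a => θ + algebraMap F K a

/-- A product of two points of the line determines the two points, up to scalars. -/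
theorem singerPt_mul {F K : Type*} [Field F] [Field K] [Algebra F K] (θ : K)
    (ind : ∀ a b c : F, algebraMap F K a + algebraMap F K b * θ + algebraMap F K c * θ ^ 2 = 0 →
      a = 0 ∧ b = 0 ∧ c = 0)
    (x y z w : Option F) (t : F) (ht : t ≠ 0)
    (h : singerPt θ x * singerPt θ y = algebraMap F K t * (singerPt θ z * singerPt θ w)) :
    (x = z ∧ y = w) ∨ (x = w ∧ y = z) := by
  have two : ∀ a b d e : F, a + b = d + e → a * b = d * e → (a = d ∧ b = e) ∨ (a = e ∧ b = d) := by
    intro a b d e h1 h2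
    have : (a - d) * (a - e) = 0 := by linear_combination a * h1 - h2
    rcases mul_eq_zero.1 this with h | h
    · left
      have := sub_eq_zero.1 h
      subst this
      exact ⟨rfl, by linear_combination h1⟩
    · right
      have := sub_eq_zero.1 h
      subst this
      exact ⟨rfl, by linear_combination h1⟩
  -- every point is `u θ + v`, with `(u, v) = (0, 1)` or `(1, a)`
  have rep : ∀ o : Option F, ∃ u v : F, singerPt θ o = algebraMap F K u * θ + algebraMap F K v ∧
      ((o = none ∧ u = 0 ∧ v = 1) ∨ (o = some v ∧ u = 1)) := by
    intro o
    cases o with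
    | none => exact ⟨0, 1, by simp [singerPt], Or.inl ⟨rfl, rfl, rfl⟩⟩
    | some a => exact ⟨1, a, by simp [singerPt], Or.inr ⟨rfl, rfl⟩⟩
  obtain ⟨u1, v1, e1, h1⟩ := rep x
  obtain ⟨u2, v2, e2, h2⟩ := rep y
  obtain ⟨u3, v3, e3, h3⟩ := rep z
  obtain ⟨u4, v4, e4, h4⟩ := rep w
  rw [e1, e2, e3, e4] at h
  obtain ⟨i0, i1, i2⟩ := ind (v1 * v2 - t * (v3 * v4))
    (u1 * v2 + u2 * v1 - t * (u3 * v4 + u4 * v3)) (u1 * u2 - t * (u3 * u4)) (by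
      simp only [map_sub, map_add, map_mul]
      linear_combination h)
  rcases h1 with ⟨rfl, rfl, rfl⟩ | ⟨rfl, rfl⟩ <;> rcases h2 with ⟨rfl, rfl, rfl⟩ | ⟨rfl, rfl⟩ <;>
  rcases h3 with ⟨rfl, rfl, rfl⟩ | ⟨rfl, rfl⟩ <;> rcases h4 with ⟨rfl, rfl, rfl⟩ | ⟨rfl, rfl⟩ <;>
    simp [ht, sub_eq_zero, eq_comm] at i0 i1 i2 ⊢ <;>
    first
    | (subst i1; simpa using i0)
    | (subst i2
       simp at i0 i1
       rcases two v1 v2 v3 v4 (by grind) (by grind) with h | h <;> grind)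
    | grind

theorem singer_map (q : ℕ) (hq : IsPrimePow q) :
    ∃ (F : Type) (_ : Fintype F) (L : Option F → ZMod (q ^ 2 + q + 1)), Fintype.card F = q ∧
      ∀ x y z w, L x + L y = L z + L w → (x = z ∧ y = w) ∨ (x = w ∧ y = z) := by
  obtain ⟨p, n, hp, hn, rfl⟩ := (isPrimePow_nat_iff q).1 hq
  haveI : Fact p.Prime := ⟨hp⟩
  let F := GaloisField p n
  let K := FiniteField.Extension F p 3
  have cF : Nat.card F = p ^ n := GaloisField.card p n hn.ne'
  have cK : Nat.card K = (p ^ n) ^ 3 := by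
    rw [← cF]; exact FiniteField.natCard_extension F p 3
  have hq1 : 1 < p ^ n := Nat.one_lt_pow hn.ne' hp.one_lt
  generalize p ^ n = q at *
  let pb := Field.powerBasisOfFiniteOfSeparable F K
  have hdim : pb.dim = 3 := by
    rw [← pb.finrank]; exact FiniteField.finrank_extension F p 3
  have ind : ∀ a b c : F, algebraMap F K a + algebraMap F K b * pb.gen
      + algebraMap F K c * pb.gen ^ 2 = 0 → a = 0 ∧ b = 0 ∧ c = 0 := by
    intro a b c h
    have hP : (Polynomial.C c * Polynomial.X ^ 2 + Polynomial.C b * Polynomial.X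
        + Polynomial.C a : Polynomial F) = 0 := by
      by_contra hne
      have := pb.dim_le_natDegree_of_root hne (by
        simp only [map_add, map_mul, Polynomial.aeval_C, Polynomial.aeval_X, map_pow]
        linear_combination h)
      have := this.trans Polynomial.natDegree_quadratic_le
      omega
    refine ⟨?_, ?_, ?_⟩
    · simpa using congrArg (fun P => Polynomial.coeff P 0) hP
    · simpa [Polynomial.coeff_X, Polynomial.coeff_C] using
        congrArg (fun P => Polynomial.coeff P 1) hP
    · simpa [Polynomial.coeff_X, Polynomial.coeff_C] using
        congrArg (fun P => Polynomial.coeff P 2) hP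
  have hne : ∀ x : Option F, singerPt pb.gen x ≠ 0 := by
    intro x hx
    cases x with
    | none => simp [singerPt] at hx
    | some a =>
      have := ind a 1 0 (by simpa [singerPt, add_comm] using hx)
      exact one_ne_zero this.2.1
  let φ : Fˣ →* Kˣ := Units.map (algebraMap F K : F →* K)
  have hφ : Function.Injective φ := Units.map_injective (algebraMap F K).injective
  let G := Kˣ ⧸ φ.range
  have hcyc : IsCyclic G := inferInstance
  have cr : Nat.card φ.range = q - 1 := by
    rw [← cF, ← Nat.card_units]
    exact Nat.card_range_of_injective hφ
  have cG : Nat.card G = q ^ 2 + q + 1 := by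
    have h := Subgroup.card_eq_card_quotient_mul_card_subgroup φ.range
    rw [Nat.card_units, cr, cK] at h
    have h2 : q ^ 3 - 1 = (q ^ 2 + q + 1) * (q - 1) := by
      obtain ⟨m, rfl⟩ : ∃ m, q = m + 1 := ⟨q - 1, by omega⟩
      rw [Nat.add_sub_cancel, Nat.sub_eq_iff_eq_add (Nat.one_le_pow _ _ (by omega))]
      ring
    rw [h2] at h
    exact (Nat.eq_of_mul_eq_mul_right (by omega) h).symm
  let e := zmodCyclicMulEquiv hcyc
  rw [← cG]
  refine ⟨F, Fintype.ofFinite F, fun x => (e.symm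
    (QuotientGroup.mk (Units.mk0 _ (hne x)) : G)).toAdd, ?_, ?_⟩
  · rw [Fintype.card_eq_nat_card]; exact cF
  · intro x y z w h
    rw [← toAdd_mul, ← toAdd_mul, ← map_mul, ← map_mul] at h
    have h' := e.symm.injective (Multiplicative.toAdd.injective h)
    rw [← QuotientGroup.mk_mul, ← QuotientGroup.mk_mul, eq_comm, QuotientGroup.eq] at h'
    obtain ⟨t, ht⟩ := h'
    refine singerPt_mul pb.gen ind x y z w t t.ne_zero ?_
    have h3 := congrArg (Units.val) (eq_inv_mul_iff_mul_eq.1 ht)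
    simp only [Units.val_mul, Units.val_mk0] at h3
    rw [← h3, mul_comm]
    rfl

theorem golomb_incidence (n k : ℕ) (A : Finset (ZMod (n + 1)))
    (hA : IsModularGolombRuler (n + 1) k A) :
    ∃ c : Fin (n + 1) → Bool, IsIncidence k (fun i j : Fin (n + 1) => c (j - i)) := by
  obtain ⟨hc, -, hd⟩ := hA
  change Finset (Fin (n + 1)) at A
  change A.card = k at hc
  have hd' : ∀ a ∈ A, ∀ a' ∈ A, ∀ b ∈ A, ∀ b' ∈ A, a ≠ a' → b ≠ b' →
    a - a' = b - b' → a = b ∧ a' = b' := hd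
  refine ⟨fun x => decide (x ∈ A), ?_, ?_, ?_⟩
  · intro i
    rw [← hc]
    refine Finset.card_bij (fun j _ => j - i) ?_ ?_ ?_
    · intro j hj; simpa using hj
    · intro a _ b _ h; exact sub_left_injective h
    · intro b hb; exact ⟨b + i, by simpa using hb, by simp⟩
  · intro j
    rw [← hc]
    refine Finset.card_bij (fun i _ => j - i) ?_ ?_ ?_
    · intro j hj; simpa using hj
    · intro a _ b _ h; exact sub_right_injective h
    · intro b hb; exact ⟨j - b, by simpa using hb, by simp⟩
  · intro i₁ i₂ j₁ j₂ hi hj h1 h2 h3 h4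
    simp only [decide_eq_true_eq] at h1 h2 h3 h4
    have := hd' _ h1 _ h2 _ h3 _ h4 (fun h => hj (sub_left_injective h))
      (fun h => hj (sub_left_injective h)) (by abel)
    exact hi (sub_right_injective this.1)

/-- For every prime power `q` there exists a `(q² + q + 1, q + 1)` modular
Golomb ruler; equivalently, a cyclic symmetric configuration `v_{q+1}` with
`v = q² + q + 1` exists. -/
theorem singer_modular_golomb_ruler (q : ℕ) (hq : IsPrimePow q) :
    (∃ A : Finset (ZMod (q ^ 2 + q + 1)),
      IsModularGolombRuler (q ^ 2 + q + 1) (q + 1) A) ∧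
    (∃ c : Fin (q ^ 2 + q + 1) → Bool,
      IsIncidence (q + 1) (fun i j : Fin (q ^ 2 + q + 1) => c (j - i))) := by
  have hA : ∃ A : Finset (ZMod (q ^ 2 + q + 1)),
      IsModularGolombRuler (q ^ 2 + q + 1) (q + 1) A := by
    classical
    obtain ⟨F, _, L, hF, hL⟩ := singer_map q hq
    have inj : Function.Injective L := by
      intro x z h
      rcases hL x x z z (by rw [h]) with h | h <;> exact h.1
    refine ⟨Finset.univ.image L, ?_, ?_, ?_⟩
    · rw [Finset.card_image_of_injective _ inj, Finset.card_univ, Fintype.card_option, hF]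
    · intro a _ b _ h
      exact sub_ne_zero.2 h
    · simp only [Finset.mem_image, Finset.mem_univ, true_and]
      rintro _ ⟨a, rfl⟩ _ ⟨a', rfl⟩ _ ⟨b, rfl⟩ _ ⟨b', rfl⟩ h1 h2 h
      rcases hL a b' b a' (by linear_combination h) with h | h
      · exact ⟨by rw [h.1], by rw [h.2]⟩
      · exact absurd (by rw [h.1]) h1
  refine ⟨hA, ?_⟩
  obtain ⟨A, hA⟩ := hA
  exact golomb_incidence _ _ A hA
end

section
/- For every prime power q there exists a (q² − 1, q) modular Golomb ruler; equivalently, a cyclic symmetric configuration v_q with v = q² − 1 exists (coming from the cyclic punctured affine plane AG(2,q), Bose's construction). -/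
theorem ruler_to_circulant (v k : ℕ) (hv : v ≠ 0) (A : Finset (ZMod v))
    (hA : IsModularGolombRuler v k A) :
    ∃ c : Fin v → Bool, IsIncidence k (fun i j : Fin v => c (j - i)) := by
  obtain ⟨m, rfl⟩ := Nat.exists_eq_succ_of_ne_zero hv
  change Finset (Fin (m + 1)) at A
  obtain ⟨h1, -, h3⟩ := hA
  have h1' : Finset.card (α := Fin (m + 1)) A = k := h1
  have h3' : ∀ a ∈ A, ∀ a' ∈ A, ∀ b ∈ A, ∀ b' ∈ A, a ≠ a' → b ≠ b' →
    a - a' = b - b' → a = b ∧ a' = b' := h3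
  refine ⟨fun x => decide (x ∈ A), ?_, ?_, ?_⟩
  · intro i
    rw [← h1']
    refine Finset.card_bij (fun j _ => j - i) ?_ ?_ ?_
    · intro a ha
      simpa using ha
    · intro a _ b _ h
      exact sub_left_injective h
    · intro b hb
      exact ⟨b + i, by simpa using hb, by simp⟩
  · intro j
    rw [← h1']
    refine Finset.card_bij (fun i _ => j - i) ?_ ?_ ?_
    · intro a ha
      simpa using ha
    · intro a _ b _ h
      exact sub_right_injective h
    · intro b hb
      exact ⟨j - b, by simpa using hb, by simp⟩
  · intro i₁ i₂ j₁ j₂ hi hj a b c d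
    simp only [decide_eq_true_eq] at a b c d
    have := h3' _ a _ b _ c _ d (fun h => hj (sub_left_injective h))
      (fun h => hj (sub_left_injective h)) (by rw [sub_sub_sub_cancel_right, sub_sub_sub_cancel_right])
    exact hi (sub_right_injective this.1)

theorem bose_key {K L : Type*} [Field K] [Field L] (f : K →+* L) (t : L)
    (ht : ∀ x, f x ≠ t) (a a' b b' : K) (hab : a ≠ a')
    (h : (t + f a) * (t + f b') = (t + f b) * (t + f a')) : a = b ∧ a' = b' := by
  have e : t * f (a + b' - b - a') = f (b * a' - a * b') := by
    simp only [map_sub, map_add, map_mul]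
    linear_combination h
  have h0 : a + b' - b - a' = 0 := by
    by_contra hne
    apply ht ((b * a' - a * b') / (a + b' - b - a'))
    rw [map_div₀, ← e, mul_div_cancel_right₀]
    exact (map_ne_zero f).2 hne
  have h1 : b * a' - a * b' = 0 := by
    rw [h0] at e
    rw [map_zero, mul_zero] at e
    exact (map_eq_zero f).1 e.symm
  have h2 : (a - a') * (a - b) = 0 := by
    linear_combination a * h0 + h1
  have h3 : a = b := by
    rcases mul_eq_zero.1 h2 with h | h
    · exact absurd (sub_eq_zero.1 h) hab
    · exact sub_eq_zero.1 h
  refine ⟨h3, ?_⟩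
  subst h3
  linear_combination -h0

theorem bose_fields (q : ℕ) (hq : IsPrimePow q) :
    ∃ (K L : Type) (_ : Field K) (_ : Field L) (_ : Finite K) (_ : Finite L) (_ : K →+* L),
      Nat.card K = q ∧ Nat.card L = q ^ 2 := by
  obtain ⟨p, n, hp, hn, rfl⟩ := hq
  have : Fact p.Prime := ⟨hp.nat_prime⟩
  have hf : Nonempty (GaloisField p n →ₐ[ZMod p] GaloisField p (n * 2)) := by
    rw [FiniteField.nonempty_algHom_iff_finrank_dvd, GaloisField.finrank p hn.ne',
      GaloisField.finrank p (by omega)]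
    exact dvd_mul_right _ _
  obtain ⟨f⟩ := hf
  refine ⟨GaloisField p n, GaloisField p (n * 2), inferInstance, inferInstance, inferInstance,
    inferInstance, f.toRingHom, GaloisField.card p n hn.ne', ?_⟩
  rw [GaloisField.card p _ (by omega), pow_mul]

theorem bose_ruler (q : ℕ) (hq : IsPrimePow q) :
    ∃ A : Finset (ZMod (q ^ 2 - 1)), IsModularGolombRuler (q ^ 2 - 1) q A := by
  classical
  obtain ⟨K, L, _, _, _, _, f, hK, hL⟩ := bose_fields q hq
  have hq1 := hq.one_lt
  have : ∃ t, ∀ x, f x ≠ t := by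
    by_contra! hs
    have := Nat.card_le_card_of_surjective f hs
    rw [hK, hL] at this
    nlinarith
  obtain ⟨t, ht⟩ := this
  have hu : Nat.card Lˣ = q ^ 2 - 1 := by
    rw [Nat.card_units, hL]
  have hc : IsAddCyclic (Additive Lˣ) := inferInstance
  have e : ZMod (q ^ 2 - 1) ≃+ Additive Lˣ := by
    rw [← hu]
    exact zmodAddCyclicAddEquiv hc
  have hne : ∀ a, t + f a ≠ 0 := fun a h => ht (-a) (by
    rw [map_neg]; linear_combination -h)
  let g : K → ZMod (q ^ 2 - 1) := fun a => e.symm (Additive.ofMul (Units.mk0 _ (hne a)))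
  have hg : Function.Injective g := by
    intro a b h
    apply f.injective
    simpa [g] using h
  have := Fintype.ofFinite K
  refine ⟨Finset.univ.image g, ?_, ?_, ?_⟩
  · rw [Finset.card_image_of_injective _ hg, Finset.card_univ, ← Nat.card_eq_fintype_card, hK]
  · intro a _ a' _ h
    exact sub_ne_zero.2 h
  · simp only [Finset.mem_image, Finset.mem_univ, true_and]
    rintro _ ⟨a, rfl⟩ _ ⟨a', rfl⟩ _ ⟨b, rfl⟩ _ ⟨b', rfl⟩ h _ heq
    have h2 : g a + g b' = g b + g a' := by linear_combination heq
    simp only [g, ← map_add] at h2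
    have h3 := congrArg (fun x : Additive Lˣ => ((Additive.toMul x : Lˣ) : L)) (e.symm.injective h2)
    have h4 : (t + f a) * (t + f b') = (t + f b) * (t + f a') := by simpa using h3
    obtain ⟨r, s⟩ := bose_key f t ht a a' b b' (fun h' => h (by rw [h'])) h4
    rw [r, s]
    exact ⟨rfl, rfl⟩

/-- For every prime power `q` there exists a `(q² - 1, q)` modular Golomb
ruler (Bose's construction from the cyclic punctured affine plane);
equivalently, a cyclic symmetric configuration `v_q` with `v = q² - 1`
exists. -/
theorem bose_modular_golomb_ruler (q : ℕ) (hq : IsPrimePow q) :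
    (∃ A : Finset (ZMod (q ^ 2 - 1)),
      IsModularGolombRuler (q ^ 2 - 1) q A) ∧
    (∃ c : Fin (q ^ 2 - 1) → Bool,
      IsIncidence q (fun i j : Fin (q ^ 2 - 1) => c (j - i))) := by
  obtain ⟨A, hA⟩ := bose_ruler q hq
  refine ⟨⟨A, hA⟩, ruler_to_circulant _ _ ?_ A hA⟩
  have := hq.one_lt
  have : 1 < q ^ 2 := by nlinarith
  omega
end

section
/- For every prime power q, every integer c with 2 ≤ c ≤ q + 1, every integer θ with 0 ≤ θ ≤ c + 1, and every integer δ with 0 ≤ δ < c − 1, there exists a symmetric configuration v_k with v = c(q − 1) + θ and k = c − 1 − δ. -/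
open Finset in
open Classical in
/-- Transfer from a relation on finite types to `ConfigExists`. -/
theorem configExists_of_rel {α β : Type*} [Fintype α] [Fintype β] (v k : ℕ)
    (hα : Fintype.card α = v) (hβ : Fintype.card β = v) (R : α → β → Prop)
    (hrow : ∀ a, (∑ b, if R a b then 1 else 0) = k)
    (hcol : ∀ b, (∑ a, if R a b then 1 else 0) = k)
    (hR : ∀ a a' b b', a ≠ a' → b ≠ b' → R a b → R a b' → R a' b → R a' b' → False) :
    ConfigExists v k := by
  let e := Fintype.equivFinOfCardEq hα
  let f := Fintype.equivFinOfCardEq hβ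
  refine ⟨fun i j => decide (R (e.symm i) (f.symm j)), ?_, ?_, ?_⟩
  · intro i
    rw [Finset.card_filter, ← hrow (e.symm i), ← Equiv.sum_comp f.symm]
    simp
  · intro j
    rw [Finset.card_filter, ← hcol (f.symm j), ← Equiv.sum_comp e.symm]
    simp
  · intro i₁ i₂ j₁ j₂ hi hj h1 h2 h3 h4
    simp only [decide_eq_true_eq] at h1 h2 h3 h4
    exact hR _ _ _ _ (e.symm.injective.ne hi) (f.symm.injective.ne hj) h1 h2 h3 h4

open Classical in
/-- Adding one new point and one new line through `k` flags. -/
theorem configExists_extend {α β K : Type*} [Fintype α] [Fintype β] [Fintype K] (v k : ℕ)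
    (hα : Fintype.card α = v) (hβ : Fintype.card β = v) (R : α → β → Prop)
    (hrow : ∀ a, (∑ b, if R a b then 1 else 0) = k)
    (hcol : ∀ b, (∑ a, if R a b then 1 else 0) = k)
    (hR : ∀ a a' b b', a ≠ a' → b ≠ b' → R a b → R a b' → R a' b → R a' b' → False)
    (hK : Fintype.card K = k) (r : K → α) (s : K → β) (hr : r.Injective) (hs : s.Injective)
    (hrs : ∀ m, R (r m) (s m))
    (hdr : ∀ m m' b, m ≠ m' → R (r m) b → R (r m') b → False)
    (hds : ∀ m m' a, m ≠ m' → R a (s m) → R a (s m') → False) :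
    ConfigExists (v + 1) k := by
  refine configExists_of_rel (α := Option α) (β := Option β) (v + 1) k (by simp [hα])
    (by simp [hβ])
    (fun x y => match x, y with
      | some a, some b => R a b ∧ ¬ ∃ m, r m = a ∧ s m = b
      | some a, none => ∃ m, r m = a
      | none, some b => ∃ m, s m = b
      | none, none => False) ?_ ?_ ?_
  · rintro (_ | a)
    · rw [Fintype.sum_option]
      simp only [if_false, zero_add]
      have h : (∑ b, if ∃ m, s m = b then 1 else 0) = k := by
        rw [← Finset.card_filter, ← hK, ← Finset.card_univ,
          ← Finset.card_image_of_injective _ hs]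
        congr 1
        ext b; simp
      convert h
    · rw [Fintype.sum_option]
      rw [← hrow a]
      by_cases h : ∃ m, r m = a
      · obtain ⟨m, rfl⟩ := h
        rw [← Finset.add_sum_erase Finset.univ _ (Finset.mem_univ (s m)),
          ← Finset.add_sum_erase Finset.univ (fun b => if R (r m) b then 1 else 0)
          (Finset.mem_univ (s m))]
        have h1 : ∃ m', r m' = r m := ⟨m, rfl⟩
        have h2 : ∃ m', r m' = r m ∧ s m' = s m := ⟨m, rfl, rfl⟩
        simp only [h1, h2, hrs m, if_true, not_true, and_false, if_false, zero_add]
        congr 1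
        refine Finset.sum_congr rfl fun b hb => ?_
        have : ¬ ∃ m', r m' = r m ∧ s m' = b := by
          rintro ⟨m', h, h'⟩
          rw [hr h] at h'
          exact (Finset.ne_of_mem_erase hb) h'.symm
        simp [this]
      · have h2 : ∀ b, ¬ ∃ m, r m = a ∧ s m = b := fun b ⟨m, hm, _⟩ => h ⟨m, hm⟩
        simp only [h, h2, if_false, zero_add, not_false_eq_true, and_true]
  · rintro (_ | b)
    · rw [Fintype.sum_option]
      simp only [if_false, zero_add]
      have h : (∑ b, if ∃ m, r m = b then 1 else 0) = k := by
        rw [← Finset.card_filter, ← hK, ← Finset.card_univ,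
          ← Finset.card_image_of_injective _ hr]
        congr 1
        ext b; simp
      convert h
    · rw [Fintype.sum_option]
      rw [← hcol b]
      by_cases h : ∃ m, s m = b
      · obtain ⟨m, rfl⟩ := h
        rw [← Finset.add_sum_erase Finset.univ _ (Finset.mem_univ (r m)),
          ← Finset.add_sum_erase Finset.univ (fun a => if R a (s m) then 1 else 0)
          (Finset.mem_univ (r m))]
        have h1 : ∃ m', s m' = s m := ⟨m, rfl⟩
        have h2 : ∃ m', r m' = r m ∧ s m' = s m := ⟨m, rfl, rfl⟩
        simp only [h1, h2, hrs m, if_true, not_true, and_false, if_false, zero_add]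
        congr 1
        refine Finset.sum_congr rfl fun a ha => ?_
        have : ¬ ∃ m', r m' = a ∧ s m' = s m := by
          rintro ⟨m', h, h'⟩
          rw [hs h'] at h
          exact (Finset.ne_of_mem_erase ha) h.symm
        simp [this]
      · have h2 : ∀ a, ¬ ∃ m, r m = a ∧ s m = b := fun a ⟨m, _, hm⟩ => h ⟨m, hm⟩
        simp only [h, h2, if_false, zero_add, not_false_eq_true, and_true]
  · rintro (_ | a) (_ | a') (_ | b) (_ | b') haa hbb h1 h2 h3 h4 <;> dsimp only at h1 h2 h3 h4
    any_goals first | exact haa rfl | exact hbb rfl | exact h1 | exact h2 | exact h3 | exact h4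
    · obtain ⟨m, rfl⟩ := h1
      obtain ⟨m', rfl⟩ := h2
      exact hds m m' a' (by rintro rfl; exact hbb rfl) h3.1 h4.1
    · obtain ⟨m, rfl⟩ := h3
      obtain ⟨m', rfl⟩ := h4
      exact hds m m' a (by rintro rfl; exact hbb rfl) h1.1 h2.1
    · obtain ⟨m, rfl⟩ := h1
      obtain ⟨m', rfl⟩ := h3
      exact hdr m m' b' (by rintro rfl; exact haa rfl) h2.1 h4.1
    · obtain ⟨m, rfl⟩ := h2
      obtain ⟨m', rfl⟩ := h4
      exact hdr m m' b (by rintro rfl; exact haa rfl) h1.1 h3.1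
    · exact hR a a' b b' (by rintro rfl; exact haa rfl) (by rintro rfl; exact hbb rfl)
        h1.1 h2.1 h3.1 h4.1

/-- The block matrix, extended by one row and one column for each index in `T`. -/
def extRel {I G : Type*} [CommGroup G] (B : I → I → Prop) (w : I → I → G) (σ : Equiv.Perm I)
    (T : Finset I) (S : Finset G) : (I × G) ⊕ T → (I × G) ⊕ T → Prop
  | .inl (j, u), .inl (i, t) => B j i ∧ u * t * w j i = 1 ∧ ¬ (j ∈ T ∧ i = σ j ∧ u ∈ S)
  | .inl (j, u), .inr s => j = s ∧ u ∈ S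
  | .inr s, .inl (i, t) => i = σ s ∧ (t * w s i)⁻¹ ∈ S
  | .inr s, .inr s' => s = s'

theorem extRel_ll {I G : Type*} [CommGroup G] (B : I → I → Prop) (w : I → I → G)
    (σ : Equiv.Perm I) (T : Finset I) (S : Finset G) (j i : I) (u t : G) :
    extRel B w σ T S (.inl (j, u)) (.inl (i, t)) ↔
      (B j i ∧ u * t * w j i = 1 ∧ ¬ (j ∈ T ∧ i = σ j ∧ u ∈ S)) := by
  constructor <;> exact id

theorem extRel_lr {I G : Type*} [CommGroup G] (B : I → I → Prop) (w : I → I → G)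
    (σ : Equiv.Perm I) (T : Finset I) (S : Finset G) (j : I) (u : G) (s : T) :
    extRel B w σ T S (.inl (j, u)) (.inr s) ↔ (j = s ∧ u ∈ S) := by
  constructor <;> exact id

theorem extRel_rl {I G : Type*} [CommGroup G] (B : I → I → Prop) (w : I → I → G)
    (σ : Equiv.Perm I) (T : Finset I) (S : Finset G) (s : T) (i : I) (t : G) :
    extRel B w σ T S (.inr s) (.inl (i, t)) ↔ (i = σ s ∧ (t * w s i)⁻¹ ∈ S) := by
  constructor <;> exact id

theorem extRel_rr {I G : Type*} [CommGroup G] (B : I → I → Prop) (w : I → I → G)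
    (σ : Equiv.Perm I) (T : Finset I) (S : Finset G) (s s' : T) :
    extRel B w σ T S (.inr s) (.inr s') ↔ s = s' := by
  constructor <;> exact id

open Classical in
theorem extRel_row {I G : Type*} [CommGroup G] [Fintype I] [Fintype G]
    (B : I → I → Prop) (w : I → I → G) (σ : Equiv.Perm I)
    (T : Finset I) (S : Finset G) (k : ℕ) (hS : S.card + 1 = k) (hσ : ∀ j, B j (σ j))
    (hrow : ∀ j, (∑ i, if B j i then 1 else 0) = k) (a : (I × G) ⊕ T) :
    (∑ b, if extRel B w σ T S a b then 1 else 0) = k := by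
  rw [Fintype.sum_sum_type, Fintype.sum_prod_type]
  rcases a with ⟨j, u⟩ | s
  · simp only [extRel_ll, extRel_lr, extRel_rl, extRel_rr]
    have h1 : ∀ i, (∑ t, if (B j i ∧ u * t * w j i = 1 ∧ ¬ (j ∈ T ∧ i = σ j ∧ u ∈ S))
        then 1 else 0) = if B j i ∧ ¬ (j ∈ T ∧ i = σ j ∧ u ∈ S) then 1 else 0 := by
      intro i
      have : ∀ t, (u * t * w j i = 1) ↔ t = (u * w j i)⁻¹ := by
        intro t
        rw [eq_inv_iff_mul_eq_one]
        constructor <;> intro h <;> rw [← h] <;> ac_rfl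
      simp only [this]
      by_cases h : B j i ∧ ¬ (j ∈ T ∧ i = σ j ∧ u ∈ S)
      · rw [if_pos h]
        simp [h.1, h.2]
      · rw [if_neg h]
        refine Finset.sum_eq_zero fun t _ => if_neg ?_
        tauto
    simp only [h1]
    rw [← hrow j]
    by_cases hj : j ∈ T ∧ u ∈ S
    · rw [← Finset.add_sum_erase Finset.univ _ (Finset.mem_univ (σ j)),
          ← Finset.add_sum_erase Finset.univ (fun i => if B j i then 1 else 0)
          (Finset.mem_univ (σ j))]
      have h2 : (∑ s : T, if (j = s ∧ u ∈ S) then 1 else 0) = 1 := by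
        rw [Finset.sum_eq_single ⟨j, hj.1⟩]
        · simp [hj.2]
        · rintro ⟨s, hs⟩ _ h
          refine if_neg ?_
          rintro ⟨rfl, _⟩
          exact h rfl
        · simp
      rw [h2]
      simp only [hj.1, hj.2, hσ, true_and, and_true, not_true, and_false, if_true, if_false]
      rw [zero_add, add_comm]
      congr 1
      refine Finset.sum_congr rfl fun i hi => ?_
      simp [Finset.ne_of_mem_erase hi]
    · have h2 : (∑ s : T, if (j = s ∧ u ∈ S) then 1 else 0) = 0 := by
        refine Finset.sum_eq_zero fun s _ => if_neg ?_
        rintro ⟨rfl, h⟩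
        exact hj ⟨s.2, h⟩
      rw [h2, add_zero]
      refine Finset.sum_congr rfl fun i _ => ?_
      have : ¬ (j ∈ T ∧ i = σ j ∧ u ∈ S) := by tauto
      simp [this]
  · simp only [extRel_ll, extRel_lr, extRel_rl, extRel_rr]
    have h2 : (∑ s' : T, if s = s' then 1 else 0) = 1 := by simp
    rw [h2, ← hS]
    congr 1
    rw [Finset.sum_eq_single (σ s)]
    · simp only [true_and]
      rw [← Finset.card_filter]
      refine Finset.card_bij (fun t _ => (t * w s (σ s))⁻¹) ?_ ?_ ?_
      · intro t ht; simpa using ht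
      · intro t _ t' _ h; simpa using h
      · intro u hu
        refine ⟨u⁻¹ * (w s (σ s))⁻¹, ?_, ?_⟩ <;> simp [hu]
    · intro i _ hi
      simp [hi]
    · simp

open Classical in
theorem extRel_col {I G : Type*} [CommGroup G] [Fintype I] [Fintype G]
    (B : I → I → Prop) (w : I → I → G) (σ : Equiv.Perm I)
    (T : Finset I) (S : Finset G) (k : ℕ) (hS : S.card + 1 = k) (hσ : ∀ j, B j (σ j))
    (hcol : ∀ i, (∑ j, if B j i then 1 else 0) = k) (b : (I × G) ⊕ T) :
    (∑ a, if extRel B w σ T S a b then 1 else 0) = k := by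
  rw [Fintype.sum_sum_type, Fintype.sum_prod_type]
  rcases b with ⟨i, t⟩ | s
  · simp only [extRel_ll, extRel_lr, extRel_rl, extRel_rr]
    have h1 : ∀ j, (∑ u, if (B j i ∧ u * t * w j i = 1 ∧ ¬ (j ∈ T ∧ i = σ j ∧ u ∈ S))
        then 1 else 0) =
          if B j i ∧ ¬ (j ∈ T ∧ i = σ j ∧ (t * w j i)⁻¹ ∈ S) then 1 else 0 := by
      intro j
      have : ∀ u, (u * t * w j i = 1) ↔ u = (t * w j i)⁻¹ := by
        intro u
        rw [eq_inv_iff_mul_eq_one, mul_assoc]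
      simp only [this]
      by_cases h : B j i ∧ ¬ (j ∈ T ∧ i = σ j ∧ (t * w j i)⁻¹ ∈ S)
      · rw [if_pos h, Finset.sum_eq_single (t * w j i)⁻¹]
        · exact if_pos ⟨h.1, rfl, h.2⟩
        · intro u _ hu
          exact if_neg fun hh => hu hh.2.1
        · simp
      · rw [if_neg h]
        refine Finset.sum_eq_zero fun u _ => if_neg ?_
        rintro ⟨h3, rfl, h4⟩
        exact h ⟨h3, h4⟩
    simp only [h1]
    rw [← hcol i]
    obtain ⟨j, rfl⟩ := σ.surjective i
    by_cases hj : j ∈ T ∧ (t * w j (σ j))⁻¹ ∈ S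
    · rw [← Finset.add_sum_erase Finset.univ _ (Finset.mem_univ j),
          ← Finset.add_sum_erase Finset.univ (fun j' => if B j' (σ j) then 1 else 0)
          (Finset.mem_univ j)]
      have h2 : (∑ s : T, if (σ j = σ s ∧ (t * w s (σ j))⁻¹ ∈ S) then 1 else 0) = 1 := by
        rw [Finset.sum_eq_single ⟨j, hj.1⟩]
        · exact if_pos ⟨rfl, hj.2⟩
        · rintro ⟨s, hs⟩ _ h
          refine if_neg ?_
          rintro ⟨h5, _⟩
          exact h (Subtype.ext (σ.injective h5).symm)
        · simp
      rw [h2]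
      simp only [hj.1, hj.2, hσ, true_and, and_true, not_true, and_false, if_true, if_false]
      rw [zero_add, add_comm]
      congr 1
      refine Finset.sum_congr rfl fun i hi => ?_
      simp [(Finset.ne_of_mem_erase hi).symm]
    · have h2 : (∑ s : T, if (σ j = σ s ∧ (t * w s (σ j))⁻¹ ∈ S) then 1 else 0) = 0 := by
        refine Finset.sum_eq_zero fun s _ => if_neg ?_
        rintro ⟨h3, h⟩
        obtain rfl := σ.injective h3
        exact hj ⟨s.2, h⟩
      rw [h2, add_zero]
      refine Finset.sum_congr rfl fun j' _ => ?_
      have : ¬ (j' ∈ T ∧ σ j = σ j' ∧ (t * w j' (σ j))⁻¹ ∈ S) := by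
        rintro ⟨h3, h4, h5⟩
        obtain rfl := σ.injective h4
        exact hj ⟨h3, h5⟩
      exact if_congr (and_iff_left this) rfl rfl
  · simp only [extRel_ll, extRel_lr, extRel_rl, extRel_rr]
    have h2 : (∑ s' : T, if s' = s then 1 else 0) = 1 := by simp
    rw [h2, ← hS]
    congr 1
    rw [Finset.sum_eq_single s.1]
    · simp
    · intro i _ hi
      simp [hi]
    · simp

theorem extRel_noRect {I G : Type*} [CommGroup G]
    (B : I → I → Prop) (w : I → I → G) (σ : Equiv.Perm I)
    (T : Finset I) (S : Finset G)
    (hw : ∀ j j' i i', j ≠ j' → i ≠ i' → B j i → B j i' → B j' i → B j' i' →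
      w j i * w j' i' ≠ w j i' * w j' i)
    (a a' b b' : (I × G) ⊕ T) (ha : a ≠ a') (hb : b ≠ b')
    (h1 : extRel B w σ T S a b) (h2 : extRel B w σ T S a b')
    (h3 : extRel B w σ T S a' b) (h4 : extRel B w σ T S a' b') : False := by
  -- two old columns and one new row never share an old row twice, etc.
  have key1 : ∀ (u t t' x : G), u * t * x = 1 → u * t' * x = 1 → t = t' := by
    intro u t t' x h h'
    exact mul_left_cancel (mul_right_cancel (h.trans h'.symm))
  have key2 : ∀ (u u' t x : G), u * t * x = 1 → u' * t * x = 1 → u = u' := by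
    intro u u' t x h h'
    exact mul_right_cancel (mul_right_cancel (h.trans h'.symm))
  have key3 : ∀ (u t x : G), u * t * x = 1 → (t * x)⁻¹ = u := by
    intro u t x h
    rw [inv_eq_iff_mul_eq_one, ← h]; ac_rfl
  have key4 : ∀ (u u' t t' x y z v : G), u * t * x = 1 → u * t' * y = 1 → u' * t * z = 1 →
      u' * t' * v = 1 → x * v = y * z := by
    intro u u' t t' x y z v h1 h2 h3 h4
    have e : (u * t * u' * t') * (x * v) = (u * t * u' * t') * (y * z) := by
      calc _ = (u * t * x) * (u' * t' * v) := by ac_rfl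
        _ = (u * t' * y) * (u' * t * z) := by rw [h1, h2, h3, h4]
        _ = _ := by ac_rfl
    exact mul_left_cancel e
  rcases a with ⟨j, u⟩ | ⟨s, hs⟩ <;> rcases a' with ⟨j', u'⟩ | ⟨s', hs'⟩ <;>
  rcases b with ⟨i, t⟩ | ⟨r, hr⟩ <;> rcases b' with ⟨i', t'⟩ | ⟨r', hr'⟩ <;>
  simp only [extRel_ll, extRel_lr, extRel_rl, extRel_rr] at h1 h2 h3 h4
  · by_cases hj : j = j'
    · subst hj
      exact ha (by rw [key2 _ _ _ _ h1.2.1 h3.2.1])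
    · by_cases hi : i = i'
      · subst hi
        exact hb (by rw [key1 _ _ _ _ h1.2.1 h2.2.1])
      · exact hw j j' i i' hj hi h1.1 h2.1 h3.1 h4.1
          (key4 _ _ _ _ _ _ _ _ h1.2.1 h2.2.1 h3.2.1 h4.2.1)
  all_goals clear key1 key2 key4 hw
  all_goals have hinj := σ.injective
  all_goals simp only [ne_eq, Sum.inl.injEq, Sum.inr.injEq, Prod.mk.injEq, Subtype.mk.injEq] at *
  all_goals grind [Function.Injective]

open Classical in
/-- The abstract extension construction. -/
theorem configExists_block {I G : Type*} [CommGroup G] [Fintype I] [Fintype G]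
    (B : I → I → Prop) (w : I → I → G) (σ : Equiv.Perm I) (k θ : ℕ) (hk : 1 ≤ k)
    (hkI : k ≤ Fintype.card I) (hkG : k ≤ Fintype.card G + 1) (hθ : θ ≤ Fintype.card I + 1)
    (hσ : ∀ j, B j (σ j))
    (hrow : ∀ j, (∑ i, if B j i then 1 else 0) = k)
    (hcol : ∀ i, (∑ j, if B j i then 1 else 0) = k)
    (hw : ∀ j j' i i', j ≠ j' → i ≠ i' → B j i → B j i' → B j' i → B j' i' →
      w j i * w j' i' ≠ w j i' * w j' i) :
    ConfigExists (Fintype.card I * Fintype.card G + θ) k := by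
  obtain ⟨S, -, hS⟩ := Finset.exists_subset_card_eq (s := (Finset.univ : Finset G)) (n := k - 1)
    (by rw [Finset.card_univ]; omega)
  have hS' : S.card + 1 = k := by omega
  by_cases hc : θ ≤ Fintype.card I
  · obtain ⟨T, -, hT⟩ := Finset.exists_subset_card_eq (s := (Finset.univ : Finset I)) (n := θ)
      (by rw [Finset.card_univ]; omega)
    have hcard : Fintype.card ((I × G) ⊕ T) = Fintype.card I * Fintype.card G + θ := by
      simp [hT]
    exact configExists_of_rel _ k hcard hcard (extRel B w σ T S)
      (extRel_row B w σ T S k hS' hσ hrow) (extRel_col B w σ T S k hS' hσ hcol)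
      (extRel_noRect B w σ T S hw)
  · obtain rfl : θ = Fintype.card I + 1 := by omega
    obtain ⟨K, -, hK⟩ := Finset.exists_subset_card_eq (s := (Finset.univ : Finset I)) (n := k)
      (by rw [Finset.card_univ]; omega)
    have hcard : Fintype.card ((I × G) ⊕ (Finset.univ : Finset I)) =
        Fintype.card I * Fintype.card G + Fintype.card I := by
      simp
    rw [← add_assoc]
    have hinj : Function.Injective
        (fun m : K => (Sum.inr ⟨m.1, Finset.mem_univ _⟩ : (I × G) ⊕ (Finset.univ : Finset I))) := by
      intro m m' h
      exact Subtype.ext (Subtype.mk.inj (Sum.inr.inj h))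
    refine configExists_extend (K := K) _ k hcard hcard (extRel B w σ Finset.univ S)
      (extRel_row B w σ _ S k hS' hσ hrow) (extRel_col B w σ _ S k hS' hσ hcol)
      (extRel_noRect B w σ _ S hw) (by simp [hK]) _ _ hinj hinj ?_ ?_ ?_
    · intro m; simp [extRel]
    · rintro ⟨m, hm⟩ ⟨m', hm'⟩ (⟨i, t⟩ | s) hne h1 h2 <;> simp only [extRel_ll, extRel_lr, extRel_rl, extRel_rr] at h1 h2
      · exact hne (Subtype.ext (σ.injective (h1.1.symm.trans h2.1)))
      · exact hne (Subtype.ext (by simpa using h1.trans h2.symm))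
    · rintro ⟨m, hm⟩ ⟨m', hm'⟩ (⟨j, u⟩ | s) hne h1 h2 <;> simp only [extRel_ll, extRel_lr, extRel_rl, extRel_rr] at h1 h2
      · exact hne (Subtype.ext (h1.1.symm.trans h2.1))
      · exact hne (Subtype.ext (by simpa using h1.symm.trans h2))

theorem sum_val_shift (c k : ℕ) [NeZero c] (hk : k < c) :
    (∑ x : ZMod c, if 1 ≤ x.val ∧ x.val ≤ k then 1 else 0) = k := by
  rw [← Finset.card_filter]
  have : (Finset.Icc 1 k).card = k := by simp
  conv_rhs => rw [← this]
  refine Finset.card_bij (fun x _ => x.val) ?_ ?_ ?_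
  · intro x hx; simpa using hx
  · intro x _ y _ h; exact ZMod.val_injective c h
  · intro n hn
    rw [Finset.mem_Icc] at hn
    have : (n : ZMod c).val = n := ZMod.val_cast_of_lt (by omega)
    exact ⟨n, by simp [this, hn.1, hn.2], this⟩

/-- For every prime power `q`, every `2 ≤ c ≤ q + 1`, every `0 ≤ θ ≤ c + 1`
and every `0 ≤ δ < c - 1`, a symmetric configuration `v_k` with
`v = c(q - 1) + θ` and `k = c - 1 - δ` exists. -/
theorem config_from_punctured_affine_plane_extension (q : ℕ) (hq : IsPrimePow q)
    (c θ δ : ℕ) (hc2 : 2 ≤ c) (hcq : c ≤ q + 1) (hθ : θ ≤ c + 1)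
    (hδ : δ < c - 1) :
    ConfigExists (c * (q - 1) + θ) (c - 1 - δ) := by
  classical
  obtain ⟨p, n, hp, hn, rfl⟩ := hq
  have hp' : p.Prime := hp.nat_prime
  haveI : Fact p.Prime := ⟨hp'⟩
  let F := GaloisField p n
  haveI : Fintype F := Fintype.ofFinite F
  have hF : Fintype.card F = p ^ n := by
    rw [← Nat.card_eq_fintype_card]; exact GaloisField.card p n hn.ne'
  haveI : NeZero c := ⟨by omega⟩
  have hI : Fintype.card (ZMod c) = c := ZMod.card c
  have hU : Fintype.card Fˣ = p ^ n - 1 := by rw [Fintype.card_units, hF]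
  obtain ⟨P⟩ : Nonempty (ZMod c ↪ Option F) := by
    apply Function.Embedding.nonempty_of_card_le
    rw [hI, Fintype.card_option, hF]; exact hcq
  let f : Option F → F := fun o => o.elim 1 id
  let g : Option F → F := fun o => o.elim 0 (fun _ => 1)
  have hfg : ∀ x y, x ≠ y → f x * g y - f y * g x ≠ 0 := by
    rintro (_ | x) (_ | y) h <;> simp [f, g] at h ⊢
    rwa [sub_eq_zero]
  let d : ZMod c → ZMod c → F := fun j i => f (P j) * g (P i) - f (P i) * g (P j)
  have hd : ∀ j i, j ≠ i → d j i ≠ 0 := fun j i h => hfg _ _ (P.injective.ne h)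
  let w : ZMod c → ZMod c → Fˣ := fun j i => if h : d j i ≠ 0 then Units.mk0 _ h else 1
  have hwv : ∀ j i, j ≠ i → (w j i : F) = d j i := by
    intro j i h
    simp only [w, dif_pos (hd j i h), Units.val_mk0]
  set k := c - 1 - δ with hk
  have hkc : k < c := by omega
  have hk1 : 1 ≤ k := by omega
  have hq1 : 2 ≤ p ^ n := hp'.two_le.trans (Nat.le_self_pow hn.ne' p)
  let B : ZMod c → ZMod c → Prop := fun j i => 1 ≤ (i - j).val ∧ (i - j).val ≤ k
  have hBne : ∀ j i, B j i → j ≠ i := by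
    rintro j i ⟨h, _⟩ rfl
    simp at h
  have main := configExists_block B w (Equiv.addRight (1 : ZMod c)) k θ hk1
    (by omega) (by omega) (by omega) ?_ ?_ ?_ ?_
  · rwa [hI, hU] at main
  · intro j
    have : (1 : ZMod c).val = 1 := by
      have := ZMod.val_cast_of_lt (n := c) (a := 1) (by omega)
      simpa using this
    simp [B, this, hk1]
  · intro j
    rw [← sum_val_shift c k hkc]
    rw [← Equiv.sum_comp (Equiv.subRight j)
      (fun x : ZMod c => if 1 ≤ x.val ∧ x.val ≤ k then 1 else 0)]
    refine Finset.sum_congr rfl fun x _ => ?_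
    by_cases hB : B j x
    · exact (if_pos hB).trans (if_pos hB).symm
    · exact (if_neg hB).trans (if_neg hB).symm
  · intro i
    rw [← sum_val_shift c k hkc]
    rw [← Equiv.sum_comp (Equiv.subLeft i)
      (fun x : ZMod c => if 1 ≤ x.val ∧ x.val ≤ k then 1 else 0)]
    refine Finset.sum_congr rfl fun x _ => ?_
    by_cases hB : B x i
    · exact (if_pos hB).trans (if_pos hB).symm
    · exact (if_neg hB).trans (if_neg hB).symm
  · intro j j' i i' hj hi h1 h2 h3 h4 he
    have he' := congrArg (Units.val) he
    rw [Units.val_mul, Units.val_mul, hwv _ _ (hBne _ _ h1), hwv _ _ (hBne _ _ h2),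
      hwv _ _ (hBne _ _ h3), hwv _ _ (hBne _ _ h4)] at he'
    have h0 : d j j' * d i i' = 0 := by
      have : d j j' * d i i' = d j i * d j' i' - d j i' * d j' i := by
        simp only [d]; ring
      rw [this, he', sub_self]
    exact (mul_ne_zero (hd _ _ hj) (hd _ _ hi)) h0
end

section
/- For every prime power q, every integer s with 0 ≤ s < q, and every integer δ with 0 ≤ δ < q − s, there exists a symmetric configuration v_k with v = q² − (q−1)s − 1 and k = q − s − δ. -/
lemma configExists_of_type {α : Type*} [Fintype α] (v k : ℕ)
    (hc : Fintype.card α = v) (M : α → α → Bool) (hM : IsIncidence k M) : ConfigExists v k := by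
  let e : Fin v ≃ α := (Fintype.equivFinOfCardEq hc).symm
  refine ⟨fun i j => M (e i) (e j), fun i => ?_, fun j => ?_, ?_⟩
  · rw [← hM.1 (e i)]
    exact Finset.card_bij (fun x _ => e x) (by simp) (by simp) (fun b hb => ⟨e.symm b, by simpa using hb⟩)
  · rw [← hM.2.1 (e j)]
    exact Finset.card_bij (fun x _ => e x) (by simp) (by simp) (fun b hb => ⟨e.symm b, by simpa using hb⟩)
  · intro i₁ i₂ j₁ j₂ hi hj
    exact hM.2.2 _ _ _ _ (e.injective.ne hi) (e.injective.ne hj)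

/-- Direction vectors of the affine plane: first coordinate. -/
def dirX {F : Type*} [Field F] : Option F → F
  | none => 0
  | some _ => 1

/-- Direction vectors of the affine plane: second coordinate. -/
def dirY {F : Type*} [Field F] : Option F → F
  | none => 1
  | some m => m

/-- Determinant of two direction vectors. -/
def dirDet {F : Type*} [Field F] (i j : Option F) : F := dirX i * dirY j - dirY i * dirX j

lemma dirDet_eq_zero {F : Type*} [Field F] {i j : Option F} : dirDet i j = 0 ↔ i = j := by
  cases i <;> cases j <;> simp [dirDet, dirX, dirY, sub_eq_zero, eq_comm]

lemma dirDet_norect {F : Type*} [Field F] {i₁ i₂ j₁ j₂ : Option F} {a₁ a₂ b₁ b₂ : Fˣ}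
    (h11 : (a₁ : F) * b₁ * dirDet i₁ j₁ = 1) (h12 : (a₁ : F) * b₂ * dirDet i₁ j₂ = 1)
    (h21 : (a₂ : F) * b₁ * dirDet i₂ j₁ = 1) (h22 : (a₂ : F) * b₂ * dirDet i₂ j₂ = 1) :
    (i₁ = i₂ ∧ a₁ = a₂) ∨ (j₁ = j₂ ∧ b₁ = b₂) := by
  by_cases hj : j₁ = j₂
  · right
    subst hj
    refine ⟨rfl, ?_⟩
    have hne : (a₁ : F) * dirDet i₁ j₁ ≠ 0 := by
      intro h; apply zero_ne_one (α := F); rw [← h11]; linear_combination -(b₁ : F) * h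
    apply Units.ext
    apply mul_left_cancel₀ hne
    linear_combination h11 - h12
  · left
    have hd : dirDet j₁ j₂ ≠ 0 := fun h => hj (dirDet_eq_zero.1 h)
    have hb : (b₁ : F) * b₂ * dirDet j₁ j₂ ≠ 0 := by simp [hd]
    have hx : (a₁ : F) * dirX i₁ - a₂ * dirX i₂ = 0 := by
      apply (mul_eq_zero.1 (_ : _ * ((b₁ : F) * b₂ * dirDet j₁ j₂) = 0)).resolve_right hb
      simp only [dirDet] at *
      linear_combination (b₁ * dirX j₁ : F) * (h12 - h22) - (b₂ * dirX j₂ : F) * (h11 - h21)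
    have hy : (a₁ : F) * dirY i₁ - a₂ * dirY i₂ = 0 := by
      apply (mul_eq_zero.1 (_ : _ * ((b₁ : F) * b₂ * dirDet j₁ j₂) = 0)).resolve_right hb
      simp only [dirDet] at *
      linear_combination (b₁ * dirY j₁ : F) * (h12 - h22) - (b₂ * dirY j₂ : F) * (h11 - h21)
    have hi : i₁ = i₂ := by
      rw [← dirDet_eq_zero]
      apply (mul_eq_zero.1 (_ : (a₁ : F) * _ = 0)).resolve_left a₁.ne_zero
      simp only [dirDet] at *
      linear_combination dirY i₂ * hx - dirX i₂ * hy
    subst hi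
    refine ⟨rfl, ?_⟩
    have hne : (b₁ : F) * dirDet i₁ j₁ ≠ 0 := by
      intro h; apply zero_ne_one (α := F); rw [← h11]; linear_combination -(a₁ : F) * h
    apply Units.ext
    apply mul_left_cancel₀ hne
    linear_combination h11 - h21

/-- Count of solutions in one row (or column). -/
lemma count_aux {F : Type*} [Field F] [Fintype F] [DecidableEq F] (n k : ℕ) [NeZero n] (hk : k < n)
    (φ : ZMod n → ZMod n) (hφ : Function.Bijective φ) (c : ZMod n → F)
    (hc : ∀ j, φ j ≠ 0 → c j ≠ 0) (P : ZMod n × Fˣ → Bool)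
    (hP : ∀ x, P x = true ↔ (1 ≤ (φ x.1).val ∧ (φ x.1).val ≤ k) ∧ (x.2 : F) * c x.1 = 1) :
    (Finset.univ.filter (fun x => P x = true)).card = k := by
  conv_rhs => rw [← Nat.add_sub_cancel k 1, ← Nat.card_Icc 1 k]
  refine Finset.card_bij (fun x _ => (φ x.1).val) ?_ ?_ ?_
  · intro x hx
    simp only [Finset.mem_filter, hP, Finset.mem_univ, true_and] at hx
    simpa using hx.1
  · rintro ⟨x, a⟩ hx ⟨y, b⟩ hy h
    simp only [Finset.mem_filter, hP, Finset.mem_univ, true_and] at hx hy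
    obtain rfl : x = y := hφ.1 (ZMod.val_injective n h)
    have hne : c x ≠ 0 := right_ne_zero_of_mul (a := (a : F)) (by rw [hx.2]; exact one_ne_zero)
    have : a = b := Units.ext (mul_right_cancel₀ hne (hx.2.trans hy.2.symm))
    rw [this]
  · intro t ht
    rw [Finset.mem_Icc] at ht
    obtain ⟨j, hj⟩ := hφ.2 (t : ZMod n)
    have hv : (φ j).val = t := by rw [hj, ZMod.val_cast_of_lt (by omega)]
    have hne : c j ≠ 0 := hc j (by intro h; rw [h, ZMod.val_zero] at hv; omega)
    refine ⟨(j, (Units.mk0 _ hne)⁻¹), ?_, hv⟩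
    simp only [Finset.mem_filter, hP, Finset.mem_univ, true_and, hv]
    exact ⟨ht, by simp [hne]⟩

theorem config_q_minus_one_cancel (q : ℕ) (hq : IsPrimePow q)
    (s δ : ℕ) (hs : s < q) (hδ : δ < q - s) :
    ConfigExists (q ^ 2 - (q - 1) * s - 1) (q - s - δ) := by
  classical
  obtain ⟨p, m, hp, hm, rfl⟩ := hq
  haveI : Fact p.Prime := ⟨hp.nat_prime⟩
  let F := GaloisField p m
  letI : Fintype F := Fintype.ofFinite F
  have hF : Fintype.card F = p ^ m := by
    rw [← Nat.card_eq_fintype_card]; exact GaloisField.card p m (by omega)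
  generalize p ^ m = q at *
  obtain ⟨n, hn⟩ : ∃ n, n = q + 1 - s := ⟨_, rfl⟩
  haveI : NeZero n := ⟨by omega⟩
  obtain ⟨g⟩ : Nonempty (ZMod n ↪ Option F) := by
    apply Function.Embedding.nonempty_of_card_le
    rw [ZMod.card, Fintype.card_option, hF]; omega
  let M : ZMod n × Fˣ → ZMod n × Fˣ → Bool := fun x y =>
    decide ((1 ≤ (y.1 - x.1).val ∧ (y.1 - x.1).val ≤ q - s - δ) ∧
      (x.2 : F) * y.2 * dirDet (g x.1) (g y.1) = 1)
  refine configExists_of_type (α := ZMod n × Fˣ) _ _ ?_ M ⟨?_, ?_, ?_⟩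
  · rw [Fintype.card_prod, ZMod.card, Fintype.card_units, hF, hn]
    obtain ⟨r, rfl⟩ : ∃ r, q = s + r + 1 := ⟨q - s - 1, by omega⟩
    have h1 : s + r + 1 + 1 - s = r + 2 := by omega
    have h2 : s + r + 1 - 1 = s + r := by omega
    rw [h1, h2]
    symm
    apply Nat.sub_eq_of_eq_add
    apply Nat.sub_eq_of_eq_add
    ring
  · rintro ⟨i, a⟩
    refine count_aux n _ (by omega) (fun j => j - i) (Equiv.subRight i).bijective
      (fun j => (a : F) * dirDet (g i) (g j)) ?_ _ ?_
    · intro j hj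
      refine mul_ne_zero a.ne_zero fun h => hj ?_
      rw [g.injective (dirDet_eq_zero.1 h), sub_self]
    · rintro ⟨j, b⟩
      simp only [M, decide_eq_true_eq]
      rw [show (a : F) * b * dirDet (g i) (g j) = b * (a * dirDet (g i) (g j)) by ring]
  · rintro ⟨j, b⟩
    refine count_aux n _ (by omega) (fun i => j - i) (Equiv.subLeft j).bijective
      (fun i => (b : F) * dirDet (g i) (g j)) ?_ _ ?_
    · intro i hi
      refine mul_ne_zero b.ne_zero fun h => hi ?_
      rw [g.injective (dirDet_eq_zero.1 h), sub_self]
    · rintro ⟨i, a⟩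
      simp only [M, decide_eq_true_eq]
      rw [mul_assoc]
  · rintro ⟨i₁, a₁⟩ ⟨i₂, a₂⟩ ⟨j₁, b₁⟩ ⟨j₂, b₂⟩ hi hj h11 h12 h21 h22
    simp only [M, decide_eq_true_eq] at h11 h12 h21 h22
    rcases dirDet_norect h11.2 h12.2 h21.2 h22.2 with ⟨h, h'⟩ | ⟨h, h'⟩
    · exact hi (by rw [g.injective h, h'])
    · exact hj (by rw [g.injective h, h'])
end

section
/- Let r be a prime power and let q = r² (so q is a square prime power). For every integer c with 2 ≤ c ≤ q − r and every integer δ with 0 ≤ δ < r + c, there exists a symmetric configuration v_k with v = c(q + r + 1) and k = r + c − δ. -/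
theorem config_of_incidence {α : Type} [Fintype α] [DecidableEq α] {v k : ℕ}
    (hv : Fintype.card α = v) (M : α → α → Bool) (hM : IsIncidence k M) : ConfigExists v k := by
  obtain ⟨h1, h2, h3⟩ := hM
  let e : Fin v ≃ α := (Fintype.equivFinOfCardEq hv).symm
  refine ⟨fun i j => M (e i) (e j), ?_, ?_, ?_⟩
  · intro i
    rw [← h1 (e i)]
    exact Finset.card_bij (fun j _ => e j) (by simp) (by simp)
      (fun b hb => ⟨e.symm b, by simpa using hb, by simp⟩)
  · intro i
    rw [← h2 (e i)]
    exact Finset.card_bij (fun j _ => e j) (by simp) (by simp)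
      (fun b hb => ⟨e.symm b, by simpa using hb, by simp⟩)
  · intro i₁ i₂ j₁ j₂ hi hj a b c d
    exact h3 _ _ _ _ (e.injective.ne hi) (e.injective.ne hj) a b c d

theorem exists_weight (c k s : ℕ) [NeZero c] (hk : k + 1 ≤ s + c) (hs : 1 ≤ s) :
    ∃ w : ZMod c → ℕ, (∑ d, w d = k) ∧ w 0 ≤ s ∧ ∀ d, d ≠ 0 → w d ≤ 1 := by
  have hc : 0 < c := Nat.pos_of_ne_zero (NeZero.ne c)
  by_cases h : k < c
  · obtain ⟨W, -, hW⟩ := Finset.exists_subset_card_eq (s := (Finset.univ : Finset (ZMod c)))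
      (n := k) (by rw [Finset.card_univ, ZMod.card]; omega)
    refine ⟨fun d => if d ∈ W then 1 else 0, ?_, ?_, ?_⟩
    · simp [hW]
    · dsimp only
      split_ifs <;> omega
    · intro d _
      dsimp only
      split_ifs <;> omega
  · refine ⟨fun d => (if d = 0 then k - c else 0) + 1, ?_, ?_, ?_⟩
    · rw [Finset.sum_add_distrib]
      simp [ZMod.card]
      omega
    · simp
      omega
    · intro d hd
      simp [hd]

/-- The block-circulant construction. -/
theorem config_of_difference (n t c k s : ℕ) [NeZero c] [NeZero t] (hn : 0 < n) (D : ℤ → Prop)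
    (per : ∀ z e : ℤ, D (z + n * t * e) ↔ D z)
    (sidon : ∀ x x' y y' : ℤ, D (x + y) → D (x + y') → D (x' + y) → D (x' + y') →
      ((n * t : ℤ) ∣ x - x') ∨ ((n * t : ℤ) ∣ y - y'))
    (hit : ∀ z : ℤ, ∃ m : ℤ, D (z + n * m))
    (diag : ∃ S : Finset (ZMod t), s ≤ S.card ∧ ∀ m ∈ S, D (n * (m.val : ℤ)))
    (hs : 1 ≤ s) (hc : c ≤ n) (hk : k + 1 ≤ s + c) : ConfigExists (c * t) k := by
  obtain ⟨w, hw, hw0, hw1⟩ := exists_weight c k s hk hs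
  have ht : (0 : ℤ) < t := by exact_mod_cast Nat.pos_of_ne_zero (NeZero.ne t)
  have key : ∀ z a b : ℤ, ((a : ZMod t) = (b : ZMod t)) → (D (z + n * a) ↔ D (z + n * b)) := by
    intro z a b hab
    rw [ZMod.intCast_eq_intCast_iff_dvd_sub] at hab
    obtain ⟨e, he⟩ := hab
    rw [← per (z + n * a) e]
    have : z + n * b = z + n * a + n * t * e := by
      have : b = a + t * e := by linarith
      rw [this]; ring
    rw [this]
  have hT : ∀ i j : ZMod c, ∃ T : Finset (ZMod t), T.card = w (j - i) ∧
      ∀ m ∈ T, D ((i.val : ℤ) - j.val + n * (m.val : ℤ)) := by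
    intro i j
    by_cases hij : j = i
    · subst hij
      obtain ⟨S, hS, hSD⟩ := diag
      obtain ⟨T, hTS, hTc⟩ := Finset.exists_subset_card_eq (s := S) (n := w 0) (by omega)
      refine ⟨T, by simpa using hTc, fun m hm => ?_⟩
      simpa using hSD m (hTS hm)
    · obtain ⟨m, hm⟩ := hit ((i.val : ℤ) - j.val)
      have h1 := hw1 (j - i) (sub_ne_zero.2 hij)
      obtain ⟨T, hTS, hTc⟩ := Finset.exists_subset_card_eq (s := {(m : ZMod t)}) (n := w (j - i))
        (by simpa using h1)
      refine ⟨T, hTc, fun m' hm' => ?_⟩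
      have := hTS hm'
      rw [Finset.mem_singleton] at this
      rw [key _ m'.val m (by simpa using this)]
      exact hm
  choose T hTc hTD using hT
  have inj : ∀ (i i' : ZMod c) (m m' : ZMod t),
      ((n * t : ℤ) ∣ ((i.val : ℤ) + n * m.val) - (i'.val + n * m'.val)) → (i, m) = (i', m') := by
    intro i i' m m' h
    have h1 : (n : ℤ) ∣ (i.val : ℤ) - i'.val := by
      have h2 : (n : ℤ) ∣ ((i.val : ℤ) + n * m.val) - (i'.val + n * m'.val) :=
        (Dvd.intro _ rfl).trans h
      have h3 : (i.val : ℤ) - i'.val = (((i.val : ℤ) + n * m.val) - (i'.val + n * m'.val))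
        + n * (m'.val - m.val) := by ring
      rw [h3]
      exact dvd_add h2 (Dvd.intro _ rfl)
    have hi := ZMod.val_lt i
    have hi' := ZMod.val_lt i'
    have h4 : (i.val : ℤ) - i'.val = 0 := by
      apply Int.eq_zero_of_abs_lt_dvd h1
      rw [abs_lt]
      constructor <;> omega
    have h5 : i = i' := ZMod.val_injective c (by omega)
    subst h5
    have h6 : (n * t : ℤ) ∣ n * ((m.val : ℤ) - m'.val) := by
      convert h using 1; ring
    have h7 : (t : ℤ) ∣ (m.val : ℤ) - m'.val :=
      Int.dvd_of_mul_dvd_mul_left (by omega) h6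
    have h8 := (ZMod.intCast_eq_intCast_iff_dvd_sub (m'.val : ℤ) m.val t).2 h7
    simp at h8
    rw [h8]
  have toD : ∀ (i j : ZMod c) (m l : ZMod t), m + l ∈ T i j →
      D (((i.val : ℤ) + n * m.val) + (-(j.val : ℤ) + n * l.val)) := by
    intro i j m l h
    have := hTD i j _ h
    rw [key _ _ ((m.val : ℤ) + l.val) (by simp)] at this
    convert this using 1; ring
  refine config_of_incidence (α := ZMod c × ZMod t) (by simp [ZMod.card])
    (fun x y => decide (x.2 + y.2 ∈ T x.1 y.1)) ⟨?_, ?_, ?_⟩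
  · rintro ⟨i, m⟩
    rw [Finset.card_filter, Fintype.sum_prod_type]
    rw [← hw, ← Equiv.sum_comp (Equiv.subRight i) w]
    refine Finset.sum_congr rfl fun j _ => ?_
    rw [← Finset.card_filter]
    simp only [decide_eq_true_eq, Equiv.subRight_apply]
    rw [← hTc i j]
    exact Finset.card_bij (fun l _ => m + l) (by simp) (by simp)
      (fun b hb => ⟨b - m, by simpa using hb, by simp⟩)
  · rintro ⟨j, l⟩
    rw [Finset.card_filter, Fintype.sum_prod_type]
    rw [← hw, ← Equiv.sum_comp (Equiv.subLeft j) w]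
    refine Finset.sum_congr rfl fun i _ => ?_
    rw [← Finset.card_filter]
    simp only [decide_eq_true_eq, Equiv.subLeft_apply]
    rw [← hTc i j]
    exact Finset.card_bij (fun m _ => m + l) (by simp) (by simp)
      (fun b hb => ⟨b - l, by simpa using hb, by simp⟩)
  · rintro ⟨i, m⟩ ⟨i', m'⟩ ⟨j, l⟩ ⟨j', l'⟩ hi hj a b a' b'
    simp only [decide_eq_true_eq] at a b a' b'
    rcases sidon _ _ _ _ (toD _ _ _ _ a) (toD _ _ _ _ b) (toD _ _ _ _ a') (toD _ _ _ _ b')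
      with h | h
    · exact hi (inj _ _ _ _ h)
    · apply hj
      -- the second coordinates carry a sign
      have h1 : (n : ℤ) ∣ (j'.val : ℤ) - j.val := by
        have h2 := (Dvd.intro (t : ℤ) (rfl : (n : ℤ) * t = n * t)).trans h
        have h3 : (j'.val : ℤ) - j.val = (-(j.val : ℤ) + n * l.val - (-(j'.val : ℤ) + n * l'.val))
          + n * (l'.val - l.val) := by ring
        rw [h3]
        exact dvd_add h2 (Dvd.intro _ rfl)
      have hj1 := ZMod.val_lt j
      have hj2 := ZMod.val_lt j'
      have h4 : (j'.val : ℤ) - j.val = 0 := by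
        apply Int.eq_zero_of_abs_lt_dvd h1
        rw [abs_lt]
        constructor <;> omega
      apply inj
      convert h using 1
      linear_combination (-2 : ℤ) * h4

theorem sidon_aux {F : Type} [Field F] (x0 x1 x2 u0 u1 u2 y0 y1 y2 v0 v1 v2 : F)
    (h1 : x0 * y0 + x1 * y1 + x2 * y2 = 0) (h2 : x0 * v0 + x1 * v1 + x2 * v2 = 0)
    (h3 : u0 * y0 + u1 * y1 + u2 * y2 = 0) (h4 : u0 * v0 + u1 * v1 + u2 * v2 = 0) :
    x0 * u1 = x1 * u0 ∨ y0 * v1 = y1 * v0 := by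
  have a1 : (x0 * u1 - x1 * u0) * y1 = (x2 * u0 - x0 * u2) * y2 := by
    linear_combination x0 * h3 - u0 * h1
  have a0 : (x0 * u1 - x1 * u0) * y0 = (x1 * u2 - x2 * u1) * y2 := by
    linear_combination u1 * h1 - x1 * h3
  have b : (x1 * u2 - x2 * u1) * v1 = (x2 * u0 - x0 * u2) * v0 := by
    linear_combination u2 * h2 - x2 * h4
  have : (x0 * u1 - x1 * u0) * (y0 * v1 - y1 * v0) = 0 := by
    linear_combination v1 * a0 - v0 * a1 + y2 * b
  rcases mul_eq_zero.1 this with h | h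
  · exact Or.inl (sub_eq_zero.1 h)
  · exact Or.inr (sub_eq_zero.1 h)

/-- The set of solutions of `x ^ (m + 1) = x`. -/
theorem exists_subfield_set {F : Type} [Field F] [DecidableEq F] {m : ℕ} (hm : 0 < m) {ζ : F}
    (h : IsPrimitiveRoot ζ m) :
    ∃ B : Finset F, B.card = m + 1 ∧ ∀ x, x ∈ B ↔ x ^ (m + 1) = x := by
  refine ⟨insert 0 (Polynomial.nthRootsFinset m 1), ?_, ?_⟩
  · rw [Finset.card_insert_of_notMem, h.card_nthRootsFinset]
    rw [Polynomial.mem_nthRootsFinset hm]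
    simp [hm.ne']
  · intro x
    rw [Finset.mem_insert, Polynomial.mem_nthRootsFinset hm]
    constructor
    · rintro (h | h)
      · simp [h]
      · rw [pow_succ, h, one_mul]
    · intro h
      by_cases hx : x = 0
      · exact Or.inl hx
      · right
        rw [pow_succ] at h
        exact mul_right_cancel₀ hx (by rw [h, one_mul])

theorem field_part (F : Type) [Field F] [Fintype F] (R : ℕ) (hR : 0 < R)
    (hcard : Fintype.card F = (R + 1) ^ 6)
    (hsub : ∀ (x y : F) (i : ℕ), (x - y) ^ ((R + 1) ^ i) = x ^ ((R + 1) ^ i) - y ^ ((R + 1) ^ i))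
    (hadd : ∀ (x y : F) (i : ℕ), (x + y) ^ ((R + 1) ^ i) = x ^ ((R + 1) ^ i) + y ^ ((R + 1) ^ i))
    (n t : ℕ) (hn : n = R ^ 2 + R + 1) (ht : t = R ^ 2 + 3 * R + 3) :
    ∃ D : ℤ → Prop,
    (∀ z e : ℤ, D (z + n * t * e) ↔ D z) ∧
    (∀ x x' y y' : ℤ, D (x + y) → D (x + y') → D (x' + y) → D (x' + y') →
      ((n * t : ℤ) ∣ x - x') ∨ ((n * t : ℤ) ∣ y - y')) ∧
    (∀ z : ℤ, ∃ m : ℤ, D (z + n * m)) ∧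
    (∃ S : Finset (ZMod t), R + 2 ≤ S.card ∧ ∀ m ∈ S, D (n * (m.val : ℤ))) := by
  classical
  obtain ⟨g, hg⟩ := IsCyclic.exists_generator (α := Fˣ)
  set r := R + 1 with hr
  set q := r ^ 2 with hq
  have htpos : 0 < t := by rw [ht]; positivity
  have hnpos : 0 < n := by rw [hn]; positivity
  have hord : orderOf g = n * t * (R * (R + 2)) := by
    rw [orderOf_eq_card_of_forall_mem_zpowers hg, Nat.card_eq_fintype_card, Fintype.card_units,
      hcard, hn, ht]
    apply Nat.sub_eq_of_eq_add
    rw [hr]; ring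
  have hQ : R * (R + 2) + 1 = q := by rw [hq, hr]; ring
  have hQ3 : R * t + 1 = r ^ 3 := by rw [ht, hr]; ring
  have hfix : ∀ x : F, x ^ (r ^ 6) = x := fun x => by rw [← hcard, FiniteField.pow_card]
  have hprim : IsPrimitiveRoot (g : F) (n * t * (R * (R + 2))) := by
    rw [← hord, IsPrimitiveRoot.coe_units_iff]
    exact IsPrimitiveRoot.orderOf g
  have hNpos : 0 < n * t * (R * (R + 2)) := by positivity
  set lam : F := (g : F) ^ ((R + 2) * n) with hlam
  have hlamP : IsPrimitiveRoot lam (R * t) := hprim.pow hNpos (by ring)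
  have hkapP : IsPrimitiveRoot ((g : F) ^ (n * t)) (R * (R + 2)) := hprim.pow hNpos (by ring)
  have hkP : IsPrimitiveRoot ((g : F) ^ (n * t * (R + 2))) R := hprim.pow hNpos (by ring)
  have hRt : 0 < R * t := by positivity
  obtain ⟨L, hLc, hL⟩ := exists_subfield_set hRt hlamP
  obtain ⟨K, hKc, hK⟩ := exists_subfield_set (by positivity) hkapP
  obtain ⟨k, hkc, hk⟩ := exists_subfield_set hR hkP
  rw [hQ3] at hLc hL
  rw [hQ] at hKc hK
  rw [← hr] at hkc hk
  let Tr : F → F := fun x => x + x ^ r ^ 2 + x ^ r ^ 4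
  have Tr_sub : ∀ x y, Tr (x - y) = Tr x - Tr y := by
    intro x y
    simp only [Tr, hsub]; ring
  have Tr_K : ∀ x, Tr x ∈ K := by
    intro x
    rw [hK]
    simp only [Tr, hq, hadd]
    rw [← pow_mul, ← pow_mul, ← pow_add, ← pow_add, hfix x]; ring
  have Tr_mul : ∀ c x, c ^ q = c → Tr (c * x) = c * Tr x := by
    intro c x hc
    have h4 : c ^ r ^ 4 = c := by
      have : r ^ 4 = q * q := by rw [hq]; ring
      rw [this, pow_mul, hc, hc]
    simp only [Tr, mul_pow, h4]
    rw [← hq, hc]; ring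
  have Tr_k : ∀ x ∈ L, Tr x ∈ k := by
    intro x hx
    rw [hL] at hx
    rw [hk]
    have h1 : ∀ a b : F, (a + b) ^ r = a ^ r + b ^ r := by
      intro a b; simpa using hadd a b 1
    have h4 : x ^ r ^ 4 = x ^ r := by
      have : r ^ 4 = r ^ 3 * r := by ring
      rw [this, pow_mul, hx]
    simp only [Tr, h1, h4]
    rw [← pow_mul, ← pow_mul, ← pow_succ, hx, ← pow_two]; ring
  have L_sub : ∀ x ∈ L, ∀ y ∈ L, x - y ∈ L := by
    intro x hx y hy
    rw [hL] at *
    rw [hsub, hx, hy]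
  have L_pow : ∀ x ∈ L, x ≠ 0 → ∃ i < R * t, lam ^ i = x := by
    intro x hx h0
    have : NeZero (R * t) := ⟨hRt.ne'⟩
    apply hlamP.eq_pow_of_pow_eq_one
    rw [hL, ← hQ3, pow_succ] at hx
    exact mul_right_cancel₀ h0 (by rw [hx, one_mul])
  have hDne : ∀ z : ℤ, ((g ^ z : Fˣ) : F) ≠ 0 := fun z => Units.ne_zero _
  have hlamg : ∀ i : ℕ, lam ^ i = ((g ^ ((n : ℤ) * ((R + 2) * i : ℕ)) : Fˣ) : F) := by
    intro i
    have : (n : ℤ) * ((R + 2) * i : ℕ) = ((R + 2) * n * i : ℕ) := by push_cast; ring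
    rw [this, zpow_natCast, hlam, ← pow_mul, Units.val_pow_eq_pow_val]
  have hper : ∀ z e : ℤ, Tr ((g ^ (z + n * t * e) : Fˣ) : F) = 0 ↔ Tr ((g ^ z : Fˣ) : F) = 0 := by
    intro z e
    have h1 : ((g ^ ((n : ℤ) * t * e) : Fˣ)) ^ q = g ^ ((n : ℤ) * t * e) := by
      rw [← hQ, pow_succ]
      have : (g ^ ((n : ℤ) * t * e)) ^ (R * (R + 2)) = 1 := by
        rw [← zpow_natCast, ← zpow_mul, ← orderOf_dvd_iff_zpow_eq_one, hord]
        exact ⟨e, by push_cast; ring⟩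
      rw [this, one_mul]
    have h2 : (((g ^ ((n : ℤ) * t * e) : Fˣ)) : F) ^ q = ((g ^ ((n : ℤ) * t * e) : Fˣ) : F) := by
      rw [← Units.val_pow_eq_pow_val, h1]
    rw [add_comm, zpow_add, Units.val_mul, Tr_mul _ _ h2, mul_eq_zero]
    simp only [hDne, false_or]
  refine ⟨fun z => Tr ((g ^ z : Fˣ) : F) = 0, hper, ?_, ?_, ?_⟩
  · intro x x' y y' h1 h2 h3 h4
    have fin : ∀ a b : ℤ, ((g ^ a : Fˣ) : F) * ((g ^ b : Fˣ) : F) ^ r ^ 2 =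
        ((g ^ a : Fˣ) : F) ^ r ^ 2 * ((g ^ b : Fˣ) : F) → ((n * t : ℤ) ∣ a - b) := by
      intro a b h
      have h' : (g ^ a : Fˣ) * (g ^ b) ^ r ^ 2 = (g ^ a) ^ r ^ 2 * g ^ b := by
        apply Units.ext; push_cast; exact_mod_cast h
      rw [← hq, ← hQ, pow_succ, pow_succ] at h'
      have h5 : (g ^ a) ^ (R * (R + 2)) = (g ^ b) ^ (R * (R + 2)) := by
        have : (g ^ a * g ^ b) * (g ^ b) ^ (R * (R + 2)) =
          (g ^ a * g ^ b) * (g ^ a) ^ (R * (R + 2)) := by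
          calc _ = g ^ a * ((g ^ b) ^ (R * (R + 2)) * g ^ b) := by
                rw [mul_assoc, mul_comm (g ^ b)]
            _ = _ := by rw [h']; rw [mul_assoc, mul_comm]
        exact (mul_left_cancel this).symm
      have h6 : g ^ ((a - b) * (R * (R + 2) : ℕ)) = 1 := by
        rw [zpow_mul, zpow_natCast, zpow_sub, mul_pow, h5, inv_pow, mul_inv_cancel]
      rw [← orderOf_dvd_iff_zpow_eq_one, hord] at h6
      push_cast at h6
      have hp : (0 : ℤ) < R * (R + 2) := by positivity
      exact Int.dvd_of_mul_dvd_mul_right hp.ne' h6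
    simp only [Tr, zpow_add, Units.val_mul, mul_pow] at h1 h2 h3 h4
    rcases sidon_aux _ _ _ _ _ _ _ _ _ _ _ _ h1 h2 h3 h4 with h | h
    · exact Or.inl (fin _ _ h)
    · exact Or.inr (fin _ _ h)
  · intro z
    have hlt : K.card < L.card := by
      rw [hKc, hLc, hq]
      exact Nat.pow_lt_pow_right (by omega) (by norm_num)
    obtain ⟨x, hx, y, hy, hxy, he⟩ := Finset.exists_ne_map_eq_of_card_lt_of_maps_to hlt
      (f := fun l => Tr (((g ^ z : Fˣ) : F) * l)) (fun l _ => Tr_K _)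
    obtain ⟨i, -, hi⟩ := L_pow _ (L_sub x hx y hy) (sub_ne_zero.2 hxy)
    refine ⟨((R + 2) * i : ℕ), ?_⟩
    change Tr _ = 0
    rw [zpow_add, Units.val_mul, ← hlamg, hi, mul_sub, Tr_sub]
    exact sub_eq_zero.2 he
  · set ker := L.filter (fun x => Tr x = 0) with hker
    have h1 : L.card ≤ ker.card * (L.image Tr).card := by
      apply Finset.card_le_mul_card_image
      intro b hb
      obtain ⟨x0, hx0, rfl⟩ := Finset.mem_image.1 hb
      apply Finset.card_le_card_of_injOn (fun x => x - x0)
      · intro x hx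
        simp only [Finset.coe_filter, Set.mem_ofPred_eq] at hx
        simp only [hker, Finset.coe_filter, Set.mem_ofPred_eq, Tr_sub]
        exact ⟨L_sub _ hx.1 _ hx0, sub_eq_zero.2 hx.2⟩
      · intro x _ y _ h
        exact sub_left_injective h
    have h2 : (L.image Tr).card ≤ r := by
      rw [← hkc]
      apply Finset.card_le_card
      intro y hy
      obtain ⟨x, hx, rfl⟩ := Finset.mem_image.1 hy
      exact Tr_k x hx
    have h3 : r ^ 2 ≤ ker.card := by
      have : r ^ 2 * r ≤ ker.card * r := by
        calc r ^ 2 * r = L.card := by rw [hLc]; ring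
          _ ≤ _ := h1
          _ ≤ _ := Nat.mul_le_mul_left _ h2
      exact Nat.le_of_mul_le_mul_right this (by omega)
    set J := (Finset.range t).filter (fun j => Tr (lam ^ j) = 0) with hJ
    have hlamper : ∀ i, Tr (lam ^ i) = 0 → Tr (lam ^ (i % t)) = 0 := by
      intro i h
      rw [hlamg] at h ⊢
      rw [← hper _ ((R + 2) * (i / t) : ℕ)]
      convert h using 5
      have : (i : ℤ) = i % t + t * (i / t) := (Int.emod_add_mul_ediv _ _).symm
      push_cast
      linear_combination (-(n : ℤ) * (R + 2)) * this
    have h4 : ker.card ≤ J.card * R + 1 := by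
      have hsubset : ker ⊆ insert 0 ((J ×ˢ Finset.range R).image
          (fun p => lam ^ (p.1 + t * p.2))) := by
        intro x hx
        rw [hker, Finset.mem_filter] at hx
        by_cases h0 : x = 0
        · simp [h0]
        · obtain ⟨i, hi, rfl⟩ := L_pow x hx.1 h0
          refine Finset.mem_insert_of_mem (Finset.mem_image.2 ⟨(i % t, i / t), ?_, ?_⟩)
          · rw [Finset.mem_product, hJ, Finset.mem_filter, Finset.mem_range, Finset.mem_range]
            exact ⟨⟨Nat.mod_lt _ htpos, hlamper i hx.2⟩, Nat.div_lt_of_lt_mul (by rwa [mul_comm])⟩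
          · simp only [Nat.mod_add_div]
      calc ker.card ≤ _ := Finset.card_le_card hsubset
        _ ≤ _ := Finset.card_insert_le _ _
        _ ≤ (J ×ˢ Finset.range R).card + 1 := Nat.add_le_add_right Finset.card_image_le 1
        _ = _ := by rw [Finset.card_product, Finset.card_range]
    have h5 : R + 2 ≤ J.card := by
      have : (R + 2) * R ≤ J.card * R := by
        have : r ^ 2 = (R + 2) * R + 1 := by rw [hr]; ring
        omega
      exact Nat.le_of_mul_le_mul_right this hR
    have : NeZero t := ⟨htpos.ne'⟩
    refine ⟨J.image (fun j => (((R + 2) * j : ℕ) : ZMod t)), ?_, ?_⟩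
    · rw [Finset.card_image_of_injOn]
      · exact h5
      · intro a ha b hb hab
        simp only [hJ, Finset.coe_filter, Set.mem_ofPred_eq, Finset.mem_range] at ha hb
        have hab' : ((R + 2) * a) ≡ ((R + 2) * b) [MOD t] :=
          (ZMod.natCast_eq_natCast_iff _ _ _).1 hab
        have hcop : Nat.gcd t (R + 2) = 1 := by
          have : t = 1 + (R + 2) * (R + 1) := by rw [ht]; ring
          rw [this]; simp
        have := Nat.ModEq.cancel_left_of_coprime hcop hab'
        exact Nat.ModEq.eq_of_lt_of_lt this ha.1 hb.1
    · intro m hm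
      obtain ⟨j, hj, rfl⟩ := Finset.mem_image.1 hm
      have hj2 := (Finset.mem_filter.1 hj).2
      rw [hlamg] at hj2
      rw [ZMod.val_natCast, ← hper _ (((R + 2) * j / t : ℕ))]
      convert hj2 using 5
      have : (((R + 2) * j : ℕ) : ℤ) = ((R + 2) * j % t : ℕ) + t * ((R + 2) * j / t : ℕ) := by
        exact_mod_cast (Nat.mod_add_div _ _).symm
      linear_combination (-(n : ℤ)) * this

/-- For a square prime power `q = r²`, every `2 ≤ c ≤ q - r` and every
`0 ≤ δ < r + c`, a symmetric configuration `v_k` with `v = c(q + r + 1)`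
and `k = r + c - δ` exists. -/
theorem config_from_baer_subplanes (r : ℕ) (hr : IsPrimePow r)
    (c δ : ℕ) (hc2 : 2 ≤ c) (hcq : c ≤ r ^ 2 - r) (hδ : δ < r + c) :
    ConfigExists (c * (r ^ 2 + r + 1)) (r + c - δ) := by
  obtain ⟨p, e, hp, he, rfl⟩ := hr
  have : Fact p.Prime := ⟨hp.nat_prime⟩
  have h2 : 2 ≤ p ^ e := hp.nat_prime.two_le.trans (Nat.le_self_pow he.ne' p)
  obtain ⟨R, hR⟩ : ∃ R, p ^ e = R + 1 := ⟨p ^ e - 1, by omega⟩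
  letI : Fintype (GaloisField p (e * 6)) := Fintype.ofFinite _
  obtain ⟨D, d1, d2, d3, d4⟩ := field_part (GaloisField p (e * 6)) R (by omega)
    (by rw [← Nat.card_eq_fintype_card, GaloisField.card _ _ (by omega), pow_mul, hR])
    (by intro x y i; rw [← hR, ← pow_mul]; exact sub_pow_char_pow x y _)
    (by intro x y i; rw [← hR, ← pow_mul]; exact add_pow_char_pow x y _ _) _ _ rfl rfl
  rw [hR] at hcq hδ ⊢
  have : NeZero c := ⟨by omega⟩
  have ht : (R + 1) ^ 2 + (R + 1) + 1 = R ^ 2 + 3 * R + 3 := by ring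
  have hn : (R + 1) ^ 2 - (R + 1) ≤ R ^ 2 + R + 1 := by
    have : (R + 1) ^ 2 = R ^ 2 + R + (R + 1) := by ring
    omega
  rw [ht]
  have : NeZero (R ^ 2 + 3 * R + 3) := ⟨by omega⟩
  exact config_of_difference (R ^ 2 + R + 1) _ c _ (R + 2) (by omega) D d1 d2 d3 d4
    (by omega) (by omega) (by omega)
end

section
/- Let k ≥ 2 and let M be a v×v incidence matrix of a symmetric configuration v_k. Suppose M contains an E-aggregate, i.e., a set R of k − 1 rows and a set C of k − 1 columns such that: no column of M has entry 1 in two distinct rows of R (the lines are pairwise disjoint); no row of M has entry 1 in two distinct columns of C (the points are pairwise non-collinear); and the (k−1)×(k−1) submatrix of M on the rows of R and the columns of C is a permutation matrix (exactly one 1 in each of its rows and each of its columns). Then a symmetric configuration (v+1)_k exists (the Generalized Martinetti Construction / Extension Procedure). -/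
/-- The extended matrix: the ones in `R × C` are removed, and a new row and a new column are
added, with ones at `C`, at `R` and at the corner. -/
def extMat {v : ℕ} (M : Fin v → Fin v → Bool) (R C : Finset (Fin v)) :
    Fin (v + 1) → Fin (v + 1) → Bool :=
  Fin.cases (Fin.cases true (fun j => decide (j ∈ C)))
    (fun i => Fin.cases (decide (i ∈ R)) (fun j => M i j && !(decide (i ∈ R) && decide (j ∈ C))))

section
variable {v : ℕ} (M : Fin v → Fin v → Bool) (R C : Finset (Fin v)) (i j : Fin v)

@[simp] lemma extMat_zero_zero : extMat M R C 0 0 = true := rfl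
@[simp] lemma extMat_zero_succ : extMat M R C 0 j.succ = decide (j ∈ C) := rfl
@[simp] lemma extMat_succ_zero : extMat M R C i.succ 0 = decide (i ∈ R) := rfl
@[simp] lemma extMat_succ_succ : extMat M R C i.succ j.succ =
    (M i j && !(decide (i ∈ R) && decide (j ∈ C))) := rfl
end

lemma extMat_transpose {v : ℕ} (M : Fin v → Fin v → Bool) (R C : Finset (Fin v))
    (i j : Fin (v + 1)) : extMat M R C i j = extMat (fun a b => M b a) C R j i := by
  refine Fin.cases ?_ (fun i => ?_) i <;> refine Fin.cases ?_ (fun j => ?_) j <;>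
    simp [Bool.or_comm]

lemma extMat_row {v k : ℕ} (hk : 2 ≤ k) (M : Fin v → Fin v → Bool) (R C : Finset (Fin v))
    (hrow : ∀ i, (Finset.univ.filter (fun j => M i j = true)).card = k)
    (hC : C.card = k - 1)
    (hperm : ∀ i ∈ R, ∃! j : Fin v, j ∈ C ∧ M i j = true) (i : Fin (v + 1)) :
    (Finset.univ.filter (fun j => extMat M R C i j = true)).card = k := by
  rw [Fin.card_filter_univ_succ]
  refine Fin.cases ?_ (fun i => ?_) i
  · simp [Finset.filter_mem_eq_inter, hC]
    omega
  · by_cases hi : i ∈ R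
    · obtain ⟨j, ⟨hj, hMj⟩, hu⟩ := hperm i hi
      have h : Finset.univ.filter (fun j => extMat M R C i.succ j.succ = true) =
          (Finset.univ.filter (fun j => M i j = true)).erase j := by
        ext x
        simp only [extMat_succ_succ, Finset.mem_filter, Finset.mem_univ, true_and,
          Finset.mem_erase, hi, decide_true, Bool.true_and, Bool.and_eq_true, Bool.not_eq_true',
          decide_eq_false_iff_not]
        constructor
        · rintro ⟨h1, h2⟩
          exact ⟨fun h => h2 (h ▸ hj), h1⟩
        · rintro ⟨h1, h2⟩
          exact ⟨h2, fun h => h1 (hu x ⟨h, h2⟩)⟩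
      have h3 := Finset.card_erase_of_mem
        (show j ∈ Finset.univ.filter (fun j => M i j = true) by simpa using hMj)
      rw [hrow] at h3
      simp only [Function.comp_def, extMat_succ_zero, hi, decide_true, if_true]
      rw [h, h3]
      omega
    · simpa [hi] using hrow i

/-- Generalized Martinetti construction: if an incidence matrix of a symmetric
configuration `v_k` (`k ≥ 2`) contains an E-aggregate — a set `R` of `k - 1`
rows corresponding to pairwise disjoint lines and a set `C` of `k - 1`
columns corresponding to pairwise non-collinear points, such that the
submatrix on `R × C` is a permutation matrix — then a symmetric configuration
`(v+1)_k` exists. -/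
theorem config_extension_of_E_aggregate (v k : ℕ) (hk : 2 ≤ k)
    (M : Fin v → Fin v → Bool) (hM : IsIncidence k M)
    (R C : Finset (Fin v)) (hR : R.card = k - 1) (hC : C.card = k - 1)
    (hRdisj : ∀ j : Fin v, ∀ i₁ ∈ R, ∀ i₂ ∈ R, i₁ ≠ i₂ →
      ¬(M i₁ j = true ∧ M i₂ j = true))
    (hCdisj : ∀ i : Fin v, ∀ j₁ ∈ C, ∀ j₂ ∈ C, j₁ ≠ j₂ →
      ¬(M i j₁ = true ∧ M i j₂ = true))
    (hpermRow : ∀ i ∈ R, ∃! j : Fin v, j ∈ C ∧ M i j = true)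
    (hpermCol : ∀ j ∈ C, ∃! i : Fin v, i ∈ R ∧ M i j = true) :
    ConfigExists (v + 1) k := by
  obtain ⟨hr, hc, hn⟩ := hM
  refine ⟨extMat M R C, extMat_row hk M R C hr hC hpermRow, fun j => ?_, ?_⟩
  · simp_rw [extMat_transpose M R C]
    exact extMat_row hk _ C R hc hR hpermCol j
  · intro i₁ i₂ j₁ j₂ hi hj
    induction i₁ using Fin.cases <;> induction i₂ using Fin.cases <;>
      induction j₁ using Fin.cases <;> induction j₂ using Fin.cases <;>
      simp at hi hj ⊢ <;> grind [NoRect]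
end
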